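/- Let B = kQ/I_B be a finite dimensional selfinjective k-algebra, let Q' be the quiver with two vertices 1, 2, loops β̄_1 at 1 and β̄_2 at 2, and arrows β_1 : 1 → 2 and β_2 : 2 → 1, and let A = kΓ/I_A, where Γ_0 = Q_0 ∪ Q'_0, Γ_1 = Q_1 ∪ Q'_1 ∪ {α_i : i → 1 for each vertex i ∈ Q_0}, and I_A is generated by I_B, the squares of the arrow ideal of kQ', and all products λα_i and α_iλ for paths λ of length ≥ 1. If A is an m-Igusa-Todorov algebra for some m ∈ ℕ, then A is a 1-Igusa-Todorov algebra. -/

import Mathlib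

/-!
Common framework for formalizing "On Lat-Igusa-Todorov algebras" (Barrios–Mata).

For a ring `S`, `FGMod S` is the "category" of finitely generated (left) `S`-modules;
for an Artin algebra `A`, the category `mod A` of finitely generated *right*
`A`-modules is `FGMod Aᵐᵒᵖ`.
-/

universe u v

open Function

namespace LIT

/-- The `η` invariant from Fitting's Lemma: for an endomorphism `L` of an abelian
group `G` and a subgroup `X`, the least `k` such that for all `m ≥ k` the
restriction of `L` to `L^m(X)` is a monomorphism `L^m(X) → L^{m+1}(X)`. -/
noncomputable def eta {G : Type v} [AddCommGroup G] (L : AddMonoid.End G)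
    (X : AddSubgroup G) : ℕ :=
  sInf {k : ℕ | ∀ m : ℕ, k ≤ m → Set.InjOn L (X.map (L ^ m) : Set G)}

/-- Bundled finitely generated `S`-modules. -/
structure FGMod (S : Type u) [Ring S] : Type (u + 1) where
  carrier : Type u
  [isAddCommGroup : AddCommGroup carrier]
  [isModule : Module S carrier]
  [isFinite : Module.Finite S carrier]

attribute [instance] FGMod.isAddCommGroup FGMod.isModule FGMod.isFinite

/-- The regular module `S` over itself. -/
def FGMod.regular (S : Type u) [Ring S] : FGMod S := ⟨S⟩

/-- A ring is finitely generated as a right module over itself. -/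
instance (A : Type u) [Ring A] : Module.Finite Aᵐᵒᵖ A :=
  Module.Finite.of_surjective
    ({ toFun := MulOpposite.unop
       map_add' := fun _ _ => rfl
       map_smul' := fun _ _ => rfl } : Aᵐᵒᵖ →ₗ[Aᵐᵒᵖ] A)
    (fun x => ⟨MulOpposite.op x, rfl⟩)

namespace FGMod

variable {S : Type u} [Ring S]

/-- Projectivity of a module. -/
def IsProj (M : FGMod S) : Prop := Module.Projective S M.carrier

/-- Direct sum (product) of two modules. -/
def prodMod (M N : FGMod S) : FGMod S := ⟨M.carrier × N.carrier⟩

/-- Finite direct sums. -/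
def dsum {n : ℕ} (f : Fin n → FGMod S) : FGMod S := ⟨∀ i, (f i).carrier⟩

/-- `N` is a direct summand of `M`. -/
def IsSummand (N M : FGMod S) : Prop :=
  ∃ N' : FGMod S, Nonempty (M.carrier ≃ₗ[S] N.carrier × N'.carrier)

/-- `addOf C` is `add C`: all direct summands of finite direct sums of modules of `C`. -/
def addOf (C : Set (FGMod S)) : Set (FGMod S) :=
  {N | ∃ (n : ℕ) (f : Fin n → FGMod S), (∀ i, f i ∈ C) ∧ IsSummand N (dsum f)}

/-- `f : P → M` is a projective cover: `P` projective, `f` surjective with superfluous kernel. -/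
def IsProjCover {P M : FGMod S} (f : P.carrier →ₗ[S] M.carrier) : Prop :=
  P.IsProj ∧ Surjective f ∧
    ∀ N : Submodule S P.carrier, N ⊔ LinearMap.ker f = ⊤ → N = ⊤

/-- `N` is (isomorphic to) the syzygy `Ω(M)`, i.e. the kernel of a projective cover of `M`. -/
def IsSyzygyOf (N M : FGMod S) : Prop :=
  ∃ (P : FGMod S) (f : P.carrier →ₗ[S] M.carrier),
    IsProjCover f ∧ Nonempty (N.carrier ≃ₗ[S] LinearMap.ker f)

/-- The syzygy `Ω(M)` of `M` (a choice of it; over an Artin algebra it exists and is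
unique up to isomorphism). -/
noncomputable def syz (M : FGMod S) : FGMod S :=
  letI := Classical.propDecidable (∃ N, IsSyzygyOf N M)
  if h : ∃ N, IsSyzygyOf N M then h.choose else M

/-- `SES X Y Z` : there is a short exact sequence `0 → X → Y → Z → 0`. -/
def SES (X Y Z : FGMod S) : Prop :=
  ∃ (f : X.carrier →ₗ[S] Y.carrier) (g : Y.carrier →ₗ[S] Z.carrier),
    Injective f ∧ Surjective g ∧ LinearMap.range f = LinearMap.ker g

/-- Projective dimension, via vanishing of syzygies. -/
noncomputable def pdim (M : FGMod S) : ℕ∞ :=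
  sInf ((↑) '' {n : ℕ | (syz^[n] M).IsProj})

end FGMod

open FGMod

variable {S : Type u} [Ring S]

/-- The finitistic dimension of a class of modules: the supremum of the projective
dimensions of its modules of finite projective dimension. -/
noncomputable def findim (C : Set (FGMod S)) : ℕ∞ :=
  ⨆ M ∈ {M ∈ C | pdim M ≠ ⊤}, pdim M

/-- The global dimension of a class of modules. -/
noncomputable def gldim (C : Set (FGMod S)) : ℕ∞ :=
  ⨆ M ∈ C, pdim M

/-- The defining relations of `K₀`: `[M] - [M'] - [M'']` for `M ≅ M' ⊕ M''`, and `[P]`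
for `P` projective. -/
def K0Rels (S : Type u) [Ring S] : AddSubgroup (FreeAbelianGroup (FGMod S)) :=
  AddSubgroup.closure
    ({x | ∃ M M' M'' : FGMod S,
        Nonempty (M.carrier ≃ₗ[S] M'.carrier × M''.carrier) ∧
        x = FreeAbelianGroup.of M - FreeAbelianGroup.of M' - FreeAbelianGroup.of M''} ∪
      {x | ∃ P : FGMod S, P.IsProj ∧ x = FreeAbelianGroup.of P})

/-- `K₀(A)`: the free abelian group on the modules modulo the relations above. -/
abbrev K0 (S : Type u) [Ring S] : Type (u + 1) :=
  FreeAbelianGroup (FGMod S) ⧸ K0Rels S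

/-- The class `[M]` of a module in `K₀`. -/
def toK0 (M : FGMod S) : K0 S := QuotientAddGroup.mk (FreeAbelianGroup.of M)

/-- `⟨C⟩`: the subgroup of `K₀` generated by the classes of direct summands of
modules of `C`. -/
def grpOf (C : Set (FGMod S)) : AddSubgroup (K0 S) :=
  AddSubgroup.closure {x | ∃ N M : FGMod S, M ∈ C ∧ IsSummand N M ∧ x = toK0 N}

/-- `K_D = K₀/⟨D⟩`. -/
abbrev KD (D : Set (FGMod S)) : Type (u + 1) := K0 S ⧸ grpOf D

/-- The class of a module in `K_D`. -/
def toKD (D : Set (FGMod S)) (M : FGMod S) : KD D :=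
  QuotientAddGroup.mk (toK0 M)

/-- `L` is the endomorphism `Ω̄` of `K₀` induced by the syzygy operator (it is unique). -/
def IsSyzEnd (L : AddMonoid.End (K0 S)) : Prop :=
  ∀ M : FGMod S, L (toK0 M) = toK0 (syz M)

/-- `L` is the endomorphism `Ω̄_D` of `K_D` induced by the syzygy operator. -/
def IsSyzEndD (D : Set (FGMod S)) (L : AddMonoid.End (KD D)) : Prop :=
  ∀ M : FGMod S, L (toKD D M) = toKD D (syz M)

/-- The Igusa–Todorov function `φ`, relative to the induced endomorphism `L = Ω̄` of `K₀`. -/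
noncomputable def phi (L : AddMonoid.End (K0 S)) (M : FGMod S) : ℕ :=
  eta L (grpOf {M})

/-- `φ`-dimension of a class of modules. -/
noncomputable def phidim (L : AddMonoid.End (K0 S)) (C : Set (FGMod S)) : ℕ∞ :=
  ⨆ M ∈ C, (phi L M : ℕ∞)

/-- The generalized Igusa–Todorov function `φ_[D]`, relative to `L = Ω̄_D`. -/
noncomputable def phiD (D : Set (FGMod S)) (L : AddMonoid.End (KD D)) (M : FGMod S) : ℕ :=
  eta L ((grpOf {M}).map (QuotientAddGroup.mk' (grpOf D)))

/-- The generalized Igusa–Todorov function `ψ_[D]`. -/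
noncomputable def psiD (D : Set (FGMod S)) (L : AddMonoid.End (KD D)) (M : FGMod S) : ℕ∞ :=
  (phiD D L M : ℕ∞) + findim (addOf {syz^[phiD D L M] M})

/-- `D` is a `0`-Igusa–Todorov subcategory: `D = add D`, `Ω(D) ⊆ D` and `φdim D = 0`. -/
def IsZeroIT (L : AddMonoid.End (K0 S)) (D : Set (FGMod S)) : Prop :=
  D = addOf D ∧ (∀ M ∈ D, syz M ∈ D) ∧ phidim L D = 0

/-- The class `C` is `(n,V,D)`-Lat-Igusa-Todorov: every `M ∈ C` admits an exact sequence
`0 → V₁ ⊕ D₁ → V₀ ⊕ D₀ → Ωⁿ(M) → 0` with `V₁, V₀ ∈ add V` and `D₁, D₀ ∈ D`. -/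
def IsLITClass (n : ℕ) (V : FGMod S) (D : Set (FGMod S)) (C : Set (FGMod S)) : Prop :=
  ∀ M ∈ C, ∃ V1 V0 D1 D0 : FGMod S,
    V1 ∈ addOf {V} ∧ V0 ∈ addOf {V} ∧ D1 ∈ D ∧ D0 ∈ D ∧
    SES (prodMod V1 D1) (prodMod V0 D0) (syz^[n] M)

/-- `[C]_D`: the image of `⟨C⟩` in `K_D`, i.e. `(⟨C⟩ + ⟨D⟩)/⟨D⟩`. -/
def classGrpD (D C : Set (FGMod S)) : AddSubgroup (KD D) :=
  (grpOf C).map (QuotientAddGroup.mk' (grpOf D))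

/-- `C` is `D`-syzygy finite: `[Ω^k(C)]_D` is finitely generated for some `k`. -/
def DSyzFinite (D C : Set (FGMod S)) : Prop :=
  ∃ k : ℕ, (classGrpD D ((fun M => syz^[k] M) '' C)).FG

/-- The algebra is `n`-LIT: there are a `0`-Igusa–Todorov subcategory `D` and a module `V`
such that `mod A` is `(n,V,D)`-LIT. -/
def IsNLITAlgebra (L : AddMonoid.End (K0 S)) (n : ℕ) : Prop :=
  ∃ (V : FGMod S) (D : Set (FGMod S)), IsZeroIT L D ∧ IsLITClass n V D Set.univ

/-- The algebra is LIT: it is `n`-LIT for some `n`. -/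
def IsLITAlgebra (L : AddMonoid.End (K0 S)) : Prop :=
  ∃ n : ℕ, IsNLITAlgebra L n


/-! ### Path algebras of finite quivers, via generators and relations

A finite quiver is given by a vertex set `V`, an arrow set `E` and source/target
maps `s t : E → V`.  The path algebra `kQ` is presented as the quotient of the free
algebra on `V ⊕ E` by the relations making the vertices a complete set of orthogonal
idempotents and `e_{s(α)} x_α = x_α = x_α e_{t(α)}` for each arrow `α`; `kQ/J^m` is
obtained by further killing all products of `m` arrows. -/

/-- The defining relations of the path algebra `kQ`. -/
inductive PathRel (k : Type u) [Field k] (V E : Type u) [Fintype V] [DecidableEq V]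
    (s t : E → V) : FreeAlgebra k (V ⊕ E) → FreeAlgebra k (V ⊕ E) → Prop
  | vtx (v w : V) : PathRel k V E s t
      (FreeAlgebra.ι k (Sum.inl v) * FreeAlgebra.ι k (Sum.inl w))
      (if v = w then FreeAlgebra.ι k (Sum.inl v) else 0)
  | one : PathRel k V E s t (∑ v : V, FreeAlgebra.ι k (Sum.inl v)) 1
  | src (e : E) : PathRel k V E s t
      (FreeAlgebra.ι k (Sum.inl (s e)) * FreeAlgebra.ι k (Sum.inr e))
      (FreeAlgebra.ι k (Sum.inr e))
  | tgt (e : E) : PathRel k V E s t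
      (FreeAlgebra.ι k (Sum.inr e) * FreeAlgebra.ι k (Sum.inl (t e)))
      (FreeAlgebra.ι k (Sum.inr e))

/-- The path algebra `kQ`. -/
abbrev PathAlg (k : Type u) [Field k] (V E : Type u) [Fintype V] [DecidableEq V]
    (s t : E → V) : Type u :=
  RingQuot (PathRel k V E s t)

/-- The defining relations of the truncated path algebra `kQ/J^m`. -/
inductive TruncRel (k : Type u) [Field k] (V E : Type u) [Fintype V] [DecidableEq V]
    (s t : E → V) (m : ℕ) : FreeAlgebra k (V ⊕ E) → FreeAlgebra k (V ⊕ E) → Prop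
  | base {x y : FreeAlgebra k (V ⊕ E)} :
      PathRel k V E s t x y → TruncRel k V E s t m x y
  | trunc (f : Fin m → E) : TruncRel k V E s t m
      ((List.ofFn fun i => FreeAlgebra.ι k (Sum.inr (f i))).prod) 0

/-- The truncated path algebra `kQ/J^m`. -/
abbrev TruncPathAlg (k : Type u) [Field k] (V E : Type u) [Fintype V] [DecidableEq V]
    (s t : E → V) (m : ℕ) : Type u :=
  RingQuot (TruncRel k V E s t m)

/-- The idempotent `e_v` of a vertex in the path algebra. -/
noncomputable def vtx (k : Type u) [Field k] {V E : Type u} [Fintype V] [DecidableEq V]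
    (s t : E → V) (v : V) : PathAlg k V E s t :=
  RingQuot.mkRingHom (PathRel k V E s t) (FreeAlgebra.ι k (Sum.inl v))

/-- The generator `x_α` of an arrow in the path algebra. -/
noncomputable def arr (k : Type u) [Field k] {V E : Type u} [Fintype V] [DecidableEq V]
    (s t : E → V) (e : E) : PathAlg k V E s t :=
  RingQuot.mkRingHom (PathRel k V E s t) (FreeAlgebra.ι k (Sum.inr e))

/-- The adjacency matrix of the quiver: the `(i,j)` entry is the number of arrows
from `i` to `j`. -/
noncomputable def adjMatrix (V E : Type u) (s t : E → V) : Matrix V V ℕ :=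
  fun i j => Nat.card {e : E // s e = i ∧ t e = j}

/-- The quiver is strongly connected: there is a (directed) path between any two
vertices. -/
def StronglyConnected (V E : Type u) (s t : E → V) : Prop :=
  ∀ v w : V, Relation.ReflTransGen (fun a b => ∃ e : E, s e = a ∧ t e = b) v w

/-- The algebra has only trivial `0`-Igusa-Todorov subcategories: every
`0`-Igusa-Todorov subcategory of `mod A = FGMod S` consists of projective modules.
(`L` ranges over the endomorphism of `K₀` induced by the syzygy operator.) -/
def OnlyTrivialZIT (S : Type u) [Ring S] : Prop :=
  ∀ L : AddMonoid.End (K0 S), IsSyzEnd L →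
    ∀ D : Set (FGMod S), IsZeroIT L D → ∀ M ∈ D, M.IsProj

/-! ### The quiver `Γ` of Example 6.1 -/

/-- Vertices of `Γ`: the vertices of `Q` together with the two vertices `1, 2` of
`Q'`. -/
abbrev GammaV (V : Type u) : Type u := V ⊕ Fin 2

/-- Arrows of `Γ`: the arrows of `Q`, the four arrows `β̄₁ : 1→1`, `β₁ : 1→2`,
`β̄₂ : 2→2`, `β₂ : 2→1` of `Q'` (encoded as pairs `(i,j) : i → j`), and one arrow
`α_i : i → 1` for each vertex `i` of `Q`. -/
abbrev GammaE (V E : Type u) : Type u := E ⊕ ((Fin 2 × Fin 2) ⊕ V)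

/-- Source map of `Γ`. -/
def gammaSrc {V E : Type u} (s : E → V) : GammaE V E → GammaV V
  | .inl e => .inl (s e)
  | .inr (.inl p) => .inr p.1
  | .inr (.inr v) => .inl v

/-- Target map of `Γ`. -/
def gammaTgt {V E : Type u} (t : E → V) : GammaE V E → GammaV V
  | .inl e => .inl (t e)
  | .inr (.inl p) => .inr p.2
  | .inr (.inr _) => .inr 0

/-- `x` is a nonempty product of arrows, i.e. (the class of) a path of length `≥ 1`. -/
def IsArrowMonomial {k : Type u} [Field k] {V E : Type u} [Fintype V] [DecidableEq V]
    (s t : E → V) (x : PathAlg k V E s t) : Prop :=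
  ∃ (n : ℕ) (f : Fin (n + 1) → E),
    x = (List.ofFn fun i => arr k s t (f i)).prod

/-- The ideal `I_A` of `kΓ`, generated by `I_B`, the squares of the arrow ideal of
`kQ'`, and all `λα_i`, `α_iλ` for paths `λ` of length `≥ 1`. -/
noncomputable def exampleIdeal (k V E : Type u) [Field k] [Fintype V] [DecidableEq V]
    (s t : E → V) (IB : TwoSidedIdeal (PathAlg k V E s t))
    (ι : PathAlg k V E s t →ₙₐ[k]
      PathAlg k (GammaV V) (GammaE V E) (gammaSrc s) (gammaTgt t)) :
    TwoSidedIdeal (PathAlg k (GammaV V) (GammaE V E) (gammaSrc s) (gammaTgt t)) :=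
  TwoSidedIdeal.span
    ((⇑ι '' (IB : Set (PathAlg k V E s t))) ∪
      {x | ∃ p q : Fin 2 × Fin 2,
        x = arr k (gammaSrc s) (gammaTgt t) (Sum.inr (Sum.inl p)) *
            arr k (gammaSrc s) (gammaTgt t) (Sum.inr (Sum.inl q))} ∪
      {x | ∃ (i : V) (lam : PathAlg k (GammaV V) (GammaE V E) (gammaSrc s) (gammaTgt t)),
        IsArrowMonomial (gammaSrc s) (gammaTgt t) lam ∧
          (x = lam * arr k (gammaSrc s) (gammaTgt t) (Sum.inr (Sum.inr i)) ∨
            x = arr k (gammaSrc s) (gammaTgt t) (Sum.inr (Sum.inr i)) * lam)})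

/-- The class `C` is `n`-Igusa-Todorov with Igusa-Todorov module `V`: every `M ∈ C`
admits an exact sequence `0 → V₁ → V₀ → Ωⁿ(M) → 0` with `V₁, V₀ ∈ add V`. -/
def IsITClass {S : Type u} [Ring S] (n : ℕ) (V : FGMod S) (C : Set (FGMod S)) : Prop :=
  ∀ M ∈ C, ∃ V1 V0 : FGMod S, V1 ∈ addOf {V} ∧ V0 ∈ addOf {V} ∧
    SES V1 V0 (syz^[n] M)

section QuasiFrobenius

variable {R : Type u} [Ring R]

/-- `I` is maximal among the proper two-sided ideals. -/
def IsMaxTwoSided (I : Ideal R) : Prop :=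
  I.IsTwoSided ∧ (1 : R) ∉ I ∧ ∀ J : Ideal R, J.IsTwoSided → (1 : R) ∉ J → I ≤ J → J = I

theorem IsMaxTwoSided.le_or_le {m I J : Ideal R} (hm : IsMaxTwoSided m) (hI : I.IsTwoSided)
    (hJ : J.IsTwoSided) (h : I ⊓ J ≤ m) : I ≤ m ∨ J ≤ m := by
  have key : ∀ K : Ideal R, K.IsTwoSided → ¬ K ≤ m → ∃ a ∈ m, ∃ b ∈ K, a + b = 1 := by
    intro K hK hKm
    have hts : (m ⊔ K).IsTwoSided := by
      have := hm.1
      refine ⟨fun {a} b hab => ?_⟩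
      obtain ⟨x, hx, y, hy, rfl⟩ := Submodule.mem_sup.1 hab
      rw [add_mul]
      exact Submodule.add_mem_sup (m.mul_mem_right _ hx) (K.mul_mem_right _ hy)
    by_contra hne
    have h1 : (1 : R) ∉ m ⊔ K := fun h => hne (by
      obtain ⟨x, hx, y, hy, e⟩ := Submodule.mem_sup.1 h
      exact ⟨x, hx, y, hy, e⟩)
    exact hKm (le_sup_right.trans (hm.2.2 _ hts h1 le_sup_left).le)
  by_contra! hne
  obtain ⟨a, ha, b, hb, hab⟩ := key I hI hne.1
  obtain ⟨a', ha', b', hb', hab'⟩ := key J hJ hne.2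
  have := hm.1
  apply hm.2.1
  have e : (1 : R) = a * a' + a * b' + b * a' + b * b' := by
    calc (1 : R) = (a + b) * (a' + b') := by rw [hab, hab', mul_one]
      _ = _ := by noncomm_ring
  rw [e]
  refine add_mem (add_mem (add_mem ?_ ?_) ?_) (h ⟨?_, ?_⟩)
  · exact m.mul_mem_right _ ha
  · exact m.mul_mem_right _ ha
  · exact m.mul_mem_left _ ha'
  · exact I.mul_mem_right _ hb
  · exact J.mul_mem_left _ hb'

theorem finite_setOf_isMaxTwoSided [IsArtinianRing R] :
    {I : Ideal R | IsMaxTwoSided I}.Finite := by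
  classical
  obtain ⟨t, ht⟩ := Finset.exists_inf_le (fun I : {I : Ideal R // IsMaxTwoSided I} => I.1)
  have hts : ∀ s : Finset {I : Ideal R // IsMaxTwoSided I}, (s.inf (fun I => I.1)).IsTwoSided := by
    intro s
    refine ⟨fun {a} b hab => ?_⟩
    rw [Submodule.mem_finsetInf] at hab ⊢
    intro i hi
    have := i.2.1
    exact i.1.mul_mem_right _ (hab i hi)
  have key : ∀ (m : Ideal R), IsMaxTwoSided m → ∀ s : Finset {I : Ideal R // IsMaxTwoSided I},
      s.inf (fun I => I.1) ≤ m → ∃ i ∈ s, i.1 ≤ m := by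
    intro m hm s
    induction s using Finset.induction_on with
    | empty =>
      intro h
      exact absurd (h (by simp)) hm.2.1
    | insert i s hi ih =>
      intro h
      rw [Finset.inf_insert] at h
      rcases hm.le_or_le i.2.1 (hts s) h with h | h
      · exact ⟨i, by simp, h⟩
      · obtain ⟨j, hj, hjm⟩ := ih h
        exact ⟨j, by simp [hj], hjm⟩
  refine (t.image Subtype.val).finite_toSet.subset ?_
  intro m hm
  obtain ⟨i, hi, him⟩ := key m hm t (ht ⟨m, hm⟩)
  have := i.2.2.2 m hm.1 hm.2.1 him
  subst this
  simpa using ⟨hm, by simpa using hi⟩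

/-- Over a left Artinian ring, a simple module is determined by its annihilator. -/
theorem nonempty_linearEquiv_of_annihilator_le [IsArtinianRing R] {T T' : Type u}
    [AddCommGroup T] [Module R T] [IsSimpleModule R T]
    [AddCommGroup T'] [Module R T'] [IsSimpleModule R T']
    (h : Module.annihilator R T ≤ Module.annihilator R T') : Nonempty (T ≃ₗ[R] T') := by
  obtain ⟨t, ht⟩ := Finset.exists_inf_le
    (fun x : T => LinearMap.ker (LinearMap.toSpanSingleton R T x))
  let φ : R →ₗ[R] (t → T) := LinearMap.pi fun x => LinearMap.toSpanSingleton R T x.1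
  have hφ : ∀ r, φ r = 0 → ∀ y : T', r • y = 0 := by
    intro r hr
    apply Module.mem_annihilator.1
    apply h
    rw [Module.mem_annihilator]
    intro x
    have h1 : r ∈ t.inf (fun x : T => LinearMap.ker (LinearMap.toSpanSingleton R T x)) := by
      rw [Submodule.mem_finsetInf]
      intro x hx
      simpa [φ] using congrFun hr ⟨x, hx⟩
    simpa using ht x h1
  have := IsSimpleModule.nontrivial R T'
  obtain ⟨y, hy⟩ := exists_ne (0 : T')
  let ψ : R →ₗ[R] T' := LinearMap.toSpanSingleton R T' y
  obtain ⟨g, hg⟩ := IsSemisimpleModule.extension_property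
    ((LinearMap.ker φ).liftQ φ le_rfl) (by
      rw [← LinearMap.ker_eq_bot]; exact Submodule.ker_liftQ_eq_bot _ _ _ le_rfl)
    ((LinearMap.ker φ).liftQ ψ (fun r hr => by
      simpa [ψ] using hφ r (by simpa using hr) y))
  have h1 : g (φ 1) = y := by
    have := LinearMap.congr_fun hg (Submodule.Quotient.mk 1)
    simpa [ψ] using this
  classical
  have : ∃ i : t, g ∘ₗ LinearMap.single R (fun _ => T) i ≠ 0 := by
    by_contra! hne
    have : g = 0 := LinearMap.pi_ext' (fun i => by rw [hne i]; simp)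
    rw [this] at h1
    exact hy h1.symm
  obtain ⟨i, hi⟩ := this
  exact ⟨LinearEquiv.ofBijective _ (LinearMap.bijective_of_ne_zero hi)⟩

theorem isMaxTwoSided_annihilator [IsArtinianRing R] (T : Type u)
    [AddCommGroup T] [Module R T] [IsSimpleModule R T] :
    IsMaxTwoSided (Module.annihilator R T) := by
  refine ⟨inferInstance, ?_, ?_⟩
  · intro h
    have := IsSimpleModule.nontrivial R T
    obtain ⟨y, hy⟩ := exists_ne (0 : T)
    exact hy (by simpa using Module.mem_annihilator.1 h y)
  · intro J hJ h1 hle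
    obtain ⟨L, hL, hJL⟩ := Ideal.exists_le_maximal J ((Ideal.ne_top_iff_one J).2 h1)
    have : IsSimpleModule R (R ⧸ L) := isSimpleModule_iff_isCoatom.2 hL.out
    have hJa : J ≤ Module.annihilator R (R ⧸ L) := by
      intro r hr
      rw [Module.mem_annihilator]
      intro x
      obtain ⟨x, rfl⟩ := Submodule.Quotient.mk_surjective _ x
      rw [← Submodule.Quotient.mk_smul, Submodule.Quotient.mk_eq_zero]
      exact hJL (J.mul_mem_right x hr)
    obtain ⟨e⟩ := nonempty_linearEquiv_of_annihilator_le (hle.trans hJa)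
    refine le_antisymm ?_ hle
    rwa [e.annihilator_eq]

/-- Over a left self-injective ring, every proper finitely generated right ideal has a nonzero
left annihilator. -/
theorem exists_mul_eq_zero_of_fg [hinj : Module.Injective R R] (L : Submodule Rᵐᵒᵖ R) (hL : L.FG)
    (h1 : (1 : R) ∉ L) : ∃ x : R, x ≠ 0 ∧ ∀ a ∈ L, x * a = 0 := by
  obtain ⟨n, s, rfl⟩ := Submodule.fg_iff_exists_fin_generating_family.1 hL
  by_contra! hne
  let φ : R →ₗ[R] (Fin n → R) := LinearMap.pi fun i => LinearMap.toSpanSingleton R R (s i)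
  have hφ : Injective φ := by
    rw [injective_iff_map_eq_zero]
    intro x hx
    by_contra hx0
    obtain ⟨a, ha, hxa⟩ := hne x hx0
    apply hxa
    induction ha using Submodule.span_induction with
    | mem a ha => obtain ⟨i, rfl⟩ := ha; simpa [φ] using congrFun hx i
    | zero => simp
    | add a b _ _ iha ihb =>
      rw [mul_add]
      by_cases h : x * a = 0 <;> by_cases h' : x * b = 0 <;> simp_all
    | smul r a _ iha =>
      by_cases h : x * a = 0
      · rw [MulOpposite.smul_eq_mul_unop, ← mul_assoc, h, zero_mul]
      · exact absurd (iha h) h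
  obtain ⟨g, hg⟩ := hinj.out φ hφ LinearMap.id
  apply h1
  have h2 : g (φ 1) = 1 := hg 1
  have h3 : φ 1 = ∑ i, s i • (Pi.single i 1 : Fin n → R) := by
    ext j
    simp [φ, Pi.single_apply]
  rw [h3, map_sum] at h2
  rw [← h2]
  refine Submodule.sum_mem _ fun i _ => ?_
  rw [map_smul, smul_eq_mul, ← op_smul_eq_mul]
  exact Submodule.smul_mem _ _ (Submodule.subset_span ⟨i, rfl⟩)

theorem exists_mul_right_of_linearMap [hinj : Module.Injective R R] (N : Ideal R)
    (θ : N →ₗ[R] R) : ∃ d : R, ∀ x : N, θ x = x.1 * d := by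
  obtain ⟨g, hg⟩ := hinj.out N.subtype N.subtype_injective θ
  refine ⟨g 1, fun x => ?_⟩
  rw [← hg x, ← smul_eq_mul, ← map_smul]
  simp

/-- Over an Artinian left self-injective ring, every simple left module embeds in the ring. -/
theorem exists_injective_of_isSimpleModule [Module.Injective R R] [IsArtinianRing R]
    [IsNoetherian Rᵐᵒᵖ R] (T : Type u) [AddCommGroup T] [Module R T] [IsSimpleModule R T] :
    ∃ f : T →ₗ[R] R, Injective f := by
  classical
  -- every maximal two-sided ideal kills, on the right, a simple left ideal
  have h1 : ∀ m : {I : Ideal R // IsMaxTwoSided I}, ∃ (N : Ideal R), IsSimpleModule R N ∧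
      ∀ x ∈ N, ∀ r ∈ m.1, x * r = 0 := by
    intro m
    have := m.2.1
    let m' : Submodule Rᵐᵒᵖ R :=
      { carrier := m.1
        add_mem' := fun ha hb => m.1.add_mem ha hb
        zero_mem' := m.1.zero_mem
        smul_mem' := fun c x hx => m.1.mul_mem_right _ hx }
    obtain ⟨x, hx, hxm⟩ := exists_mul_eq_zero_of_fg m' (IsNoetherian.noetherian _) m.2.2.1
    let K : Ideal R :=
      { carrier := {x | ∀ r ∈ m.1, x * r = 0}
        add_mem' := fun {a b} ha hb r hr => by rw [add_mul, ha r hr, hb r hr, add_zero]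
        zero_mem' := fun r _ => zero_mul r
        smul_mem' := fun c x hx r hr => by rw [smul_eq_mul, mul_assoc, hx r hr, mul_zero] }
    have hK : K ≠ ⊥ := fun h => hx (by
      have : x ∈ K := hxm
      rw [h] at this
      simpa using this)
    obtain ⟨N, hN, hNK⟩ := (IsAtomic.eq_bot_or_exists_atom_le K).resolve_left hK
    exact ⟨N, isSimpleModule_iff_isAtom.2 hN, fun x hx => hNK hx⟩
  choose N hNs hN using h1
  let φ : {I : Ideal R // IsMaxTwoSided I} → {I : Ideal R // IsMaxTwoSided I} :=
    fun m => ⟨Module.annihilator R (N m), isMaxTwoSided_annihilator _⟩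
  have hφ : Injective φ := by
    intro m m' h
    obtain ⟨e⟩ := nonempty_linearEquiv_of_annihilator_le (congrArg Subtype.val h).le
    obtain ⟨d, hd⟩ := exists_mul_right_of_linearMap (N m) ((N m').subtype ∘ₗ e.toLinearMap)
    have := IsSimpleModule.nontrivial R (N m)
    obtain ⟨s, hs⟩ := exists_ne (0 : N m)
    let J : Ideal R :=
      { carrier := {r | ∀ c, (e s).1 * c * r = 0}
        add_mem' := fun {a b} ha hb c => by rw [mul_add, ha c, hb c, add_zero]
        zero_mem' := fun c => mul_zero _
        smul_mem' := fun c x hx c' => by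
          rw [smul_eq_mul, ← mul_assoc, mul_assoc _ c' c, hx] }
    have hJ : J.IsTwoSided := ⟨fun {a} b ha c => by
      rw [← mul_assoc, ha c, zero_mul]⟩
    have hJ1 : (1 : R) ∉ J := fun h => hs (by
      have := h 1
      simpa using this)
    have t1 := m.2.1
    have t2 := m'.2.1
    have e1 : J = m.1 := m.2.2.2 J hJ hJ1 fun r hr c => by
      have h3 := hd s
      simp only [LinearMap.comp_apply, Submodule.subtype_apply, LinearEquiv.coe_coe] at h3
      rw [h3, mul_assoc, mul_assoc]
      exact hN m _ s.2 _ (m.1.mul_mem_left _ (m.1.mul_mem_left _ hr))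
    have e2 : J = m'.1 := m'.2.2.2 J hJ hJ1 fun r hr c => by
      rw [mul_assoc]
      exact hN m' _ (e s).2 _ (m'.1.mul_mem_left _ hr)
    exact Subtype.ext (e1.symm.trans e2)
  have : Finite {I : Ideal R // IsMaxTwoSided I} := finite_setOf_isMaxTwoSided.to_subtype
  obtain ⟨m, hm⟩ := Finite.surjective_of_injective hφ
    ⟨Module.annihilator R T, isMaxTwoSided_annihilator T⟩
  obtain ⟨e⟩ := nonempty_linearEquiv_of_annihilator_le (congrArg Subtype.val hm).ge
  exact ⟨(N m).subtype ∘ₗ e.toLinearMap, (N m).subtype_injective.comp e.injective⟩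

/-- Over an Artinian left self-injective ring, every finitely generated left module embeds in a
free module of finite rank. -/
theorem exists_injective_pi [hinj : Module.Injective R R] [IsArtinianRing R]
    [IsNoetherian Rᵐᵒᵖ R] (M : Type u) [AddCommGroup M] [Module R M] [Module.Finite R M] :
    ∃ (n : ℕ) (f : M →ₗ[R] (Fin n → R)), Injective f := by
  have sep : ∀ x : M, x ≠ 0 → ∃ h : M →ₗ[R] R, h x ≠ 0 := by
    intro x hx
    let a : R →ₗ[R] M := LinearMap.toSpanSingleton R M x
    have ha : LinearMap.ker a ≠ ⊤ := fun h => hx (by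
      have : (1 : R) ∈ LinearMap.ker a := h ▸ Submodule.mem_top
      simpa [a] using this)
    obtain ⟨L, hL, haL⟩ := Ideal.exists_le_maximal _ ha
    have : IsSimpleModule R (R ⧸ L) := isSimpleModule_iff_isCoatom.2 hL.out
    obtain ⟨f, hf⟩ := exists_injective_of_isSimpleModule (R := R) (R ⧸ L)
    obtain ⟨g, hg⟩ := hinj.out ((LinearMap.ker a).liftQ a le_rfl) (by
      rw [← LinearMap.ker_eq_bot]; exact Submodule.ker_liftQ_eq_bot _ _ _ le_rfl)
      ((LinearMap.ker a).liftQ (f ∘ₗ L.mkQ) (fun r hr => by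
        have : L.mkQ r = 0 := by simpa using haL hr
        simp only [LinearMap.mem_ker, LinearMap.comp_apply, this, map_zero]))
    refine ⟨g, fun h0 => ?_⟩
    have h2 := hg (Submodule.Quotient.mk 1)
    simp only [Submodule.liftQ_apply, LinearMap.comp_apply, a, LinearMap.toSpanSingleton_apply,
      one_smul, h0] at h2
    have h3 : L.mkQ 1 = 0 := hf (by rw [← h2, map_zero])
    exact hL.ne_top ((Ideal.eq_top_iff_one L).2 (by simpa using h3))
  obtain ⟨t, ht⟩ := Finset.exists_inf_le (fun h : M →ₗ[R] R => LinearMap.ker h)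
  refine ⟨t.card, LinearMap.pi fun i => (t.equivFin.symm i).1, ?_⟩
  rw [injective_iff_map_eq_zero]
  intro x hx
  by_contra hx0
  obtain ⟨h, hh⟩ := sep x hx0
  apply hh
  apply ht h
  rw [Submodule.mem_finsetInf]
  intro g hg
  simpa using congrFun hx (t.equivFin ⟨g, hg⟩)

end QuasiFrobenius

section Retracts

variable {R : Type u} [Ring R]

/-- `N` is a direct summand of a finite power of `V`. -/
def IsRetract (R : Type u) [Ring R] (V N : Type u) [AddCommGroup V] [Module R V]
    [AddCommGroup N] [Module R N] : Prop :=
  ∃ (n : ℕ) (i : Fin n → N →ₗ[R] V) (p : Fin n → V →ₗ[R] N), ∀ x, ∑ a, p a (i a x) = x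

variable {V W N N' : Type u} [AddCommGroup V] [Module R V]
  [AddCommGroup W] [Module R W] [AddCommGroup N] [Module R N] [AddCommGroup N'] [Module R N']

theorem IsRetract.of_fintype {ι : Type*} [Fintype ι] (i : ι → N →ₗ[R] V) (p : ι → V →ₗ[R] N)
    (h : ∀ x, ∑ a, p a (i a x) = x) : IsRetract R V N := by
  classical
  refine ⟨Fintype.card ι, fun a => i ((Fintype.equivFin ι).symm a),
    fun a => p ((Fintype.equivFin ι).symm a), fun x => ?_⟩
  exact ((Fintype.equivFin ι).symm.sum_comp fun a => p a (i a x)).trans (h x)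

theorem IsRetract.of_comp_eq_id (i : N →ₗ[R] V) (p : V →ₗ[R] N) (h : ∀ x, p (i x) = x) :
    IsRetract R V N :=
  ⟨1, fun _ => i, fun _ => p, fun x => by simpa using h x⟩

theorem IsRetract.of_equiv (e : V ≃ₗ[R] N) : IsRetract R V N :=
  .of_comp_eq_id e.symm.toLinearMap e.toLinearMap fun x => e.apply_symm_apply x

theorem IsRetract.trans (h : IsRetract R V W) (h' : IsRetract R W N) : IsRetract R V N := by
  obtain ⟨n, i, p, h⟩ := h
  obtain ⟨n', i', p', h'⟩ := h'
  refine .of_fintype (ι := Fin n' × Fin n) (fun a => i a.2 ∘ₗ i' a.1)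
    (fun a => p' a.1 ∘ₗ p a.2) fun x => ?_
  rw [Fintype.sum_prod_type]
  conv_rhs => rw [← h' x]
  refine Finset.sum_congr rfl fun a _ => ?_
  simp only [LinearMap.comp_apply]
  rw [← map_sum, h]

theorem IsRetract.prod (h : IsRetract R V N) (h' : IsRetract R V N') :
    IsRetract R V (N × N') := by
  obtain ⟨n, i, p, h⟩ := h
  obtain ⟨n', i', p', h'⟩ := h'
  refine .of_fintype (ι := Fin n ⊕ Fin n')
    (Sum.elim (fun a => i a ∘ₗ .fst R N N') (fun a => i' a ∘ₗ .snd R N N'))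
    (Sum.elim (fun a => .inl R N N' ∘ₗ p a) (fun a => .inr R N N' ∘ₗ p' a)) fun x => ?_
  rw [Fintype.sum_sum_type]
  simp only [Sum.elim_inl, Sum.elim_inr, LinearMap.comp_apply, LinearMap.fst_apply,
    LinearMap.snd_apply, ← map_sum, h, h']
  simp

theorem IsRetract.fst : IsRetract R (V × W) V :=
  .of_comp_eq_id (.inl R V W) (.fst R V W) fun _ => rfl

theorem IsRetract.snd : IsRetract R (V × W) W :=
  .of_comp_eq_id (.inr R V W) (.snd R V W) fun _ => rfl

theorem IsRetract.pi (n : ℕ) : IsRetract R V (Fin n → V) := by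
  classical
  refine ⟨n, fun a => .proj a, fun a => .single R (fun _ => V) a, fun x => ?_⟩
  simp only [LinearMap.proj_apply, LinearMap.coe_single]
  exact Finset.univ_sum_single x

theorem IsRetract.projective (h : IsRetract R R N) : Module.Projective R N := by
  obtain ⟨n, i, p, h⟩ := h
  refine Module.Projective.of_split (M := Fin n → R) (LinearMap.pi i)
    (∑ a, p a ∘ₗ LinearMap.proj a) ?_
  ext x
  simpa using h x

theorem IsRetract.of_projective [Module.Finite R N] [Module.Projective R N] :
    IsRetract R R N := by
  obtain ⟨n, f, hf⟩ := Module.Finite.exists_fin' R N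
  obtain ⟨g, hg⟩ := Module.projective_lifting_property f .id hf
  exact (IsRetract.pi n).trans (.of_comp_eq_id g f fun x => LinearMap.congr_fun hg x)

theorem mem_addOf_singleton {V N : FGMod R} :
    N ∈ addOf {V} ↔ IsRetract R V.carrier N.carrier := by
  classical
  constructor
  · rintro ⟨n, f, hf, N', ⟨e⟩⟩
    obtain rfl : f = fun _ => V := funext hf
    exact ((IsRetract.pi n).trans (.of_equiv (R := R) (V := Fin n → V.carrier) e)).trans .fst
  · rintro ⟨n, i, p, h⟩
    let I : N.carrier →ₗ[R] (Fin n → V.carrier) := LinearMap.pi i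
    let P : (Fin n → V.carrier) →ₗ[R] N.carrier := ∑ a, p a ∘ₗ LinearMap.proj a
    have hPI : ∀ x, P (I x) = x := fun x => by simpa [P, I] using h x
    let q : (Fin n → V.carrier) →ₗ[R] LinearMap.ker P :=
      (LinearMap.id - I ∘ₗ P).codRestrict _ (fun x => by simp [hPI])
    have hq : Surjective q := fun x => ⟨x.1, Subtype.ext (by
      have := x.2
      rw [LinearMap.mem_ker] at this
      simp [q, this])⟩
    have : Module.Finite R (LinearMap.ker P) := Module.Finite.of_surjective q hq
    have e : (Fin n → V.carrier) ≃ₗ[R] (N.carrier × LinearMap.ker P) :=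
      LinearEquiv.ofLinearMap (P.prod q) (I.coprod (LinearMap.ker P).subtype)
        (by
          refine LinearMap.ext fun x => ?_
          have hx : P x.2.1 = 0 := x.2.2
          refine Prod.ext ?_ (Subtype.ext ?_)
          · simp [hPI, hx]
          · simp [q, hPI, hx])
        (by
          refine LinearMap.ext fun x => ?_
          simp [q])
    exact ⟨n, fun _ => V, fun _ => rfl, ⟨LinearMap.ker P⟩, ⟨e⟩⟩

end Retracts

section Syzygies

variable {S : Type u} [Ring S]

theorem exists_isSyzygyOf [IsArtinianRing S] [IsNoetherianRing S] (M : FGMod S) :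
    ∃ N, IsSyzygyOf N M := by
  obtain ⟨n, f, hf⟩ := Module.Finite.exists_fin' S M.carrier
  obtain ⟨N, ⟨hNp, hNs⟩, hmin⟩ := WellFounded.has_min
    (wellFounded_lt (α := Submodule S (Fin n → S)))
    {N | Module.Projective S N ∧ N.map f = ⊤}
    ⟨⊤, Module.Projective.of_equiv (Submodule.topEquiv (R := S) (M := Fin n → S)).symm, by
      rw [Submodule.map_top, LinearMap.range_eq_top]; exact hf⟩
  let g : N →ₗ[S] M.carrier := f ∘ₗ N.subtype
  have hg : Surjective g := by
    rw [← LinearMap.range_eq_top, LinearMap.range_comp, Submodule.range_subtype, hNs]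
  refine ⟨⟨LinearMap.ker g⟩, ⟨N⟩, g, ⟨hNp, hg, fun N₁ hN₁ => ?_⟩, ⟨LinearEquiv.refl _ _⟩⟩
  change Submodule S N at N₁
  have hs : Surjective (g ∘ₗ N₁.subtype) := by
    intro y
    obtain ⟨x, rfl⟩ := hg y
    have hx : x ∈ N₁ ⊔ LinearMap.ker g := hN₁ ▸ Submodule.mem_top
    obtain ⟨a, ha, b, hb, rfl⟩ := Submodule.mem_sup.1 hx
    exact ⟨⟨a, ha⟩, by simpa using hb⟩
  obtain ⟨h₀, hh₀⟩ := Module.projective_lifting_property _ g hs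
  let h : Module.End S N := N₁.subtype ∘ₗ h₀
  have hgh : ∀ x, g (h x) = g x := fun x => LinearMap.congr_fun hh₀ x
  have hghk : ∀ (k : ℕ) x, g ((h ^ k) x) = g x := by
    intro k
    induction k with
    | zero => intro x; rfl
    | succ k ih => intro x; rw [pow_succ', Module.End.mul_apply, hgh, ih]
  obtain ⟨k, hk⟩ := Filter.eventually_atTop.1 h.eventually_isCompl_ker_pow_range_pow
  have hk := hk (k + 1) (Nat.le_succ k)
  have hproj : Module.Projective S (LinearMap.range (h ^ (k + 1))) :=
    Module.Projective.of_split (LinearMap.range (h ^ (k + 1))).subtype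
      (Submodule.projectionOnto _ _ hk.symm)
      (Submodule.projectionOnto_comp_subtype hk.symm)
  have hN₂ := hmin ((LinearMap.range (h ^ (k + 1))).map N.subtype)
    ⟨Module.Projective.of_equiv
      (Submodule.equivMapOfInjective N.subtype N.subtype_injective _), by
      rw [← Submodule.map_comp, eq_top_iff]
      intro y _
      obtain ⟨x, rfl⟩ := hg y
      exact ⟨(h ^ (k + 1)) x, ⟨x, rfl⟩, hghk _ x⟩⟩
  have hle : (LinearMap.range (h ^ (k + 1))).map N.subtype ≤ N := Submodule.map_subtype_le _ _
  have heq := hle.eq_of_not_lt hN₂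
  rw [eq_top_iff]
  intro x _
  have hx : x.1 ∈ (LinearMap.range (h ^ (k + 1))).map N.subtype := heq.symm ▸ x.2
  obtain ⟨y, ⟨z, rfl⟩, hy⟩ := hx
  have : (h ^ (k + 1)) z = x := Subtype.ext hy
  rw [← this, pow_succ', Module.End.mul_apply]
  exact (h₀ _).2

theorem isSyzygyOf_syz [IsArtinianRing S] [IsNoetherianRing S] (M : FGMod S) :
    IsSyzygyOf (syz M) M := by
  have h := exists_isSyzygyOf M
  have e : syz M = h.choose := by
    unfold syz
    exact dif_pos h
  rw [e]
  exact h.choose_spec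

theorem exists_linearMap_ne_zero {P : Type u} [AddCommGroup P] [Module S P]
    [hP : Module.Projective S P] {x : P} (hx : x ≠ 0) : ∃ φ : P →ₗ[S] S, φ x ≠ 0 := by
  obtain ⟨s, hs⟩ := hP.out
  by_contra! h
  have : s x = 0 := by
    ext a
    exact h (Finsupp.lapply a ∘ₗ s)
  apply hx
  rw [← hs x, this, map_zero]

variable {k : Type u} [Field k] [Algebra k S]

/-- The kernel of a projective cover is killed by every `g` generating a one-dimensional right
ideal. -/
theorem IsProjCover.smul_eq_zero {P M : FGMod S} {f : P.carrier →ₗ[S] M.carrier}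
    (hf : IsProjCover f) {g : S} (hg : ∀ s, ∃ c : k, g * s = c • g) {x : P.carrier}
    (hx : f x = 0) : g • x = 0 := by
  by_contra hgx
  have : Module.Projective S P.carrier := hf.1
  obtain ⟨φ, hφ⟩ := exists_linearMap_ne_zero (S := S) hgx
  let N : Submodule S P.carrier :=
    { carrier := {y | g * φ y = 0}
      add_mem' := fun {a b} ha hb => by
        simp only [Set.mem_ofPred_eq] at *
        rw [map_add, mul_add, ha, hb, add_zero]
      zero_mem' := by simp
      smul_mem' := fun s y hy => by
        obtain ⟨c, hc⟩ := hg s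
        simp only [Set.mem_ofPred_eq] at *
        rw [map_smul, smul_eq_mul, ← mul_assoc, hc, smul_mul_assoc, hy, smul_zero] }
  have hN : N ⊔ LinearMap.ker f = ⊤ := by
    rw [eq_top_iff]
    intro y _
    obtain ⟨c, hc⟩ := hg (φ x)
    obtain ⟨d, hd⟩ := hg (φ y)
    have hc0 : c ≠ 0 := by
      rintro rfl
      rw [zero_smul] at hc
      exact hφ (by rw [map_smul, smul_eq_mul, hc])
    have hz : φ (algebraMap k S (d / c) • x) = (d / c) • φ x := by
      rw [map_smul, smul_eq_mul, Algebra.smul_def]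
    refine Submodule.mem_sup.2 ⟨y - algebraMap k S (d / c) • x, ?_,
      algebraMap k S (d / c) • x, ?_, sub_add_cancel _ _⟩
    · change g * φ (y - algebraMap k S (d / c) • x) = 0
      rw [map_sub, hz, mul_sub, hd, mul_smul_comm, hc, smul_smul, div_mul_cancel₀ _ hc0, sub_self]
    · exact (LinearMap.ker f).smul_mem _ hx
  have hx' : x ∈ N := (hf.2.2 N hN).symm ▸ Submodule.mem_top
  exact hφ (by rw [map_smul]; exact hx')

end Syzygies

section Schanuel

variable {R : Type u} [Ring R] {K P N F X : Type u}
  [AddCommGroup K] [Module R K] [AddCommGroup P] [Module R P] [AddCommGroup N] [Module R N]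
  [AddCommGroup F] [Module R F] [AddCommGroup X] [Module R X]

/-- Schanuel's lemma. -/
theorem schanuel [Module.Projective R P] [Module.Projective R F]
    {i : K →ₗ[R] P} {f : P →ₗ[R] X} (hi : Injective i) (hf : Surjective f)
    (hif : LinearMap.range i = LinearMap.ker f)
    {j : N →ₗ[R] F} {g : F →ₗ[R] X} (hj : Injective j) (hg : Surjective g)
    (hjg : LinearMap.range j = LinearMap.ker g) : Nonempty ((K × F) ≃ₗ[R] (N × P)) := by
  obtain ⟨a, ha⟩ := Module.projective_lifting_property g f hg
  obtain ⟨b, hb⟩ := Module.projective_lifting_property f g hf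
  have ha : ∀ x, g (a x) = f x := LinearMap.congr_fun ha
  have hb : ∀ x, f (b x) = g x := LinearMap.congr_fun hb
  let eK : K ≃ₗ[R] LinearMap.ker f := (LinearEquiv.ofInjective i hi).trans (.ofEq _ _ hif)
  let eN : N ≃ₗ[R] LinearMap.ker g := (LinearEquiv.ofInjective j hj).trans (.ofEq _ _ hjg)
  let u : (LinearMap.ker f × F) →ₗ[R] P :=
    (LinearMap.ker f).subtype.coprod b
  let v : (LinearMap.ker g × P) →ₗ[R] F :=
    (LinearMap.ker g).subtype.coprod a
  have hu : ∀ x, f (u x) = g x.2 := fun x => by simp [u, hb]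
  have hv : ∀ x, g (v x) = f x.2 := fun x => by simp [v, ha]
  have e : (LinearMap.ker f × F) ≃ₗ[R] (LinearMap.ker g × P) :=
    LinearEquiv.ofLinearMap
      (((LinearMap.snd R _ _ - a ∘ₗ u).codRestrict (LinearMap.ker g)
        (fun x => by simp [ha, hu])).prod u)
      (((LinearMap.snd R _ _ - b ∘ₗ v).codRestrict (LinearMap.ker f)
        (fun x => by simp [hb, hv])).prod v)
      (by
        refine LinearMap.ext fun x => Prod.ext (Subtype.ext ?_) ?_ <;> simp [u, v])
      (by
        refine LinearMap.ext fun x => Prod.ext (Subtype.ext ?_) ?_ <;> simp [u, v])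
  exact ⟨(eK.prodCongr (.refl R F)).trans (e.trans (eN.symm.prodCongr (.refl R P)))⟩

end Schanuel

/-- A ring homomorphism with a multiplicative (not necessarily unital) additive section. -/
structure Corner (S R : Type u) [Ring S] [Ring R] where
  /-- The ring homomorphism. -/
  toHom : S →+* R
  /-- The section. -/
  sec : R →+ S
  sec_mul : ∀ a b, sec (a * b) = sec a * sec b
  toHom_sec : ∀ a, toHom (sec a) = a

namespace Corner

variable {S R : Type u} [Ring S] [Ring R] (C : Corner S R)

theorem surjective : Surjective C.toHom := fun a => ⟨C.sec a, C.toHom_sec a⟩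

section Restriction

/-- Restriction of scalars along the ring homomorphism of a corner. -/
def res (N : FGMod R) : FGMod S :=
  letI : Module S N.carrier := Module.compHom N.carrier C.toHom
  { carrier := N.carrier
    isFinite := by
      have : RingHomSurjective C.toHom := ⟨C.surjective⟩
      obtain ⟨s, hs⟩ := Module.Finite.fg_top (R := R) (M := N.carrier)
      refine ⟨s, ?_⟩
      rw [eq_top_iff]
      intro x _
      have hx : x ∈ Submodule.span R (s : Set N.carrier) := hs ▸ Submodule.mem_top
      induction hx using Submodule.span_induction with
      | mem x hx => exact Submodule.subset_span hx
      | zero => exact zero_mem _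
      | add x y _ _ hx hy => exact add_mem (hx trivial) (hy trivial)
      | smul r x _ hx =>
        obtain ⟨r, rfl⟩ := C.surjective r
        exact Submodule.smul_mem (Submodule.span S (s : Set N.carrier)) r (hx trivial) }

/-- Restriction of scalars on linear maps. -/
def resMap {N N' : FGMod R} (f : N.carrier →ₗ[R] N'.carrier) :
    (C.res N).carrier →ₗ[S] (C.res N').carrier where
  toFun := f
  map_add' := f.map_add
  map_smul' s x := f.map_smul (C.toHom s) x

theorem isRetract_res {V N : FGMod R} (h : IsRetract R V.carrier N.carrier) :
    IsRetract S (C.res V).carrier (C.res N).carrier := by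
  obtain ⟨n, i, p, h⟩ := h
  exact ⟨n, fun a => C.resMap (i a), fun a => C.resMap (p a), h⟩

end Restriction

section Fixed

variable (M : Type u) [AddCommGroup M] [Module S M]

/-- The elements of `M` fixed by the idempotent of a corner. -/
def fix : AddSubgroup M where
  carrier := {x | C.sec 1 • x = x}
  add_mem' := fun {a b} ha hb => by
    simp only [Set.mem_ofPred_eq] at *
    rw [smul_add, ha, hb]
  zero_mem' := smul_zero _
  neg_mem' := fun {a} ha => by
    simp only [Set.mem_ofPred_eq] at *
    rw [smul_neg, ha]

variable {M}

theorem mem_fix {x : M} : x ∈ C.fix M ↔ C.sec 1 • x = x := Iff.rfl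

theorem sec_smul_mem_fix (r : R) (x : M) : C.sec r • x ∈ C.fix M := by
  rw [mem_fix, ← mul_smul, ← C.sec_mul, one_mul]

instance : Module R (C.fix M) where
  smul r x := ⟨C.sec r • x.1, C.sec_smul_mem_fix r _⟩
  one_smul x := Subtype.ext x.2
  mul_smul r r' x := Subtype.ext (by
    change C.sec (r * r') • x.1 = C.sec r • C.sec r' • x.1
    rw [C.sec_mul, mul_smul])
  smul_zero r := Subtype.ext (smul_zero (C.sec r))
  smul_add r x y := Subtype.ext (smul_add (C.sec r) x.1 y.1)
  add_smul r r' x := Subtype.ext (by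
    change C.sec (r + r') • x.1 = C.sec r • x.1 + C.sec r' • x.1
    rw [map_add, add_smul])
  zero_smul x := Subtype.ext (by
    change C.sec 0 • x.1 = 0
    rw [map_zero, zero_smul])

variable {M' : Type u} [AddCommGroup M'] [Module S M']

/-- The linear map induced on fixed elements. -/
def fixMap (f : M →ₗ[S] M') : C.fix M →ₗ[R] C.fix M' where
  toFun x := ⟨f x.1, by rw [mem_fix, ← map_smul, C.mem_fix.1 x.2]⟩
  map_add' x y := Subtype.ext (f.map_add x.1 y.1)
  map_smul' r x := Subtype.ext (f.map_smul (C.sec r) x.1)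

theorem coe_fixMap (f : M →ₗ[S] M') (x : C.fix M) : (C.fixMap f x : M') = f x.1 := rfl

theorem isRetract_fix (h : IsRetract S M M') : IsRetract R (C.fix M) (C.fix M') := by
  obtain ⟨n, i, p, h⟩ := h
  refine ⟨n, fun a => C.fixMap (i a), fun a => C.fixMap (p a), fun x => Subtype.ext ?_⟩
  rw [AddSubgroup.val_finsetSum]
  exact h x.1

theorem injective_fixMap {f : M →ₗ[S] M'} (hf : Injective f) : Injective (C.fixMap f) :=
  fun _ _ h => Subtype.ext (hf (congrArg Subtype.val h))

theorem surjective_fixMap {f : M →ₗ[S] M'} (hf : Surjective f) : Surjective (C.fixMap f) := by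
  intro y
  obtain ⟨x, hx⟩ := hf y.1
  exact ⟨⟨C.sec 1 • x, C.sec_smul_mem_fix 1 x⟩, Subtype.ext (by
    rw [coe_fixMap, map_smul, hx, C.mem_fix.1 y.2])⟩

theorem range_fixMap {M'' : Type u} [AddCommGroup M''] [Module S M''] {f : M →ₗ[S] M'}
    {g : M' →ₗ[S] M''} (hf : Injective f) (h : LinearMap.range f = LinearMap.ker g) :
    LinearMap.range (C.fixMap f) = LinearMap.ker (C.fixMap g) := by
  ext x
  constructor
  · rintro ⟨y, rfl⟩
    have : f y.1 ∈ LinearMap.ker g := h ▸ ⟨y.1, rfl⟩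
    exact Subtype.ext this
  · intro hx
    have : x.1 ∈ LinearMap.range f := h ▸ (congrArg Subtype.val hx : g x.1 = 0)
    obtain ⟨y, hy⟩ := this
    exact ⟨⟨y, hf (by rw [map_smul, hy, C.mem_fix.1 x.2])⟩, Subtype.ext hy⟩

variable (M) in
/-- The idempotent of the corner acts on `M` compatibly with the ring homomorphism. -/
def Compatible : Prop := ∀ (s : S) (x : M), C.sec 1 • s • x = C.sec (C.toHom s) • x

/-- The fixed elements of a compatible finitely generated module. -/
def fixMod (M : FGMod S) (h : C.Compatible M.carrier) : FGMod R where
  carrier := C.fix M.carrier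
  isFinite := by
    have : RingHomSurjective C.toHom := ⟨C.surjective⟩
    let p : M.carrier →ₛₗ[C.toHom] C.fix M.carrier :=
      { toFun := fun x => ⟨C.sec 1 • x, C.sec_smul_mem_fix 1 x⟩
        map_add' := fun x y => Subtype.ext (smul_add _ _ _)
        map_smul' := fun s x => Subtype.ext (by
          change C.sec 1 • s • x = C.sec (C.toHom s) • C.sec 1 • x
          rw [h, ← mul_smul, ← C.sec_mul, mul_one]) }
    exact Module.Finite.of_surjective p fun y => ⟨y.1, Subtype.ext y.2⟩

/-- The projection of a compatible module onto its fixed elements. -/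
def proj (M : FGMod S) (h : C.Compatible M.carrier) :
    M.carrier →ₗ[S] (C.res (C.fixMod M h)).carrier where
  toFun x := (⟨C.sec 1 • x, C.sec_smul_mem_fix 1 x⟩ : C.fix M.carrier)
  map_add' x y := Subtype.ext (smul_add _ x y)
  map_smul' s x := Subtype.ext (by
    change C.sec 1 • s • x = C.sec (C.toHom s) • C.sec 1 • x
    rw [h, ← mul_smul, ← C.sec_mul, mul_one])

/-- The fixed elements of a restricted module. -/
def fixRes (N : FGMod R) : C.fix (C.res N).carrier ≃ₗ[R] N.carrier where
  toFun x := x.1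
  invFun x := ⟨x, by
    change C.toHom (C.sec 1) • (x : N.carrier) = x
    rw [C.toHom_sec, one_smul]⟩
  map_add' _ _ := rfl
  map_smul' r x := by
    let y : N.carrier := x.1
    change C.toHom (C.sec r) • y = r • y
    rw [C.toHom_sec]
  left_inv _ := rfl
  right_inv _ := rfl

/-- The fixed elements of the regular module. -/
def fixSelf (hC : ∀ s, C.sec 1 * s = C.sec (C.toHom s)) : R ≃ₗ[R] C.fix S where
  toFun r := ⟨C.sec r, by rw [mem_fix, smul_eq_mul, ← C.sec_mul, one_mul]⟩
  invFun x := C.toHom x.1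
  map_add' x y := Subtype.ext (C.sec.map_add x y)
  map_smul' r x := Subtype.ext (C.sec_mul r x)
  left_inv r := C.toHom_sec r
  right_inv x := Subtype.ext ((hC x.1).symm.trans x.2)

end Fixed

end Corner

section Resolutions

variable {S R : Type u} [Ring S] [Ring R]

/-- `N` has a two-term resolution by modules of `add V`. -/
def HasRes (V N : FGMod S) : Prop :=
  ∃ V1 V0 : FGMod S, V1 ∈ addOf {V} ∧ V0 ∈ addOf {V} ∧ SES V1 V0 N

theorem HasRes.of_equiv {V N N' : FGMod S} (h : HasRes V N) (e : N.carrier ≃ₗ[S] N'.carrier) :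
    HasRes V N' := by
  obtain ⟨V1, V0, h1, h0, f, g, hf, hg, hfg⟩ := h
  refine ⟨V1, V0, h1, h0, f, e.toLinearMap ∘ₗ g, hf, e.surjective.comp hg, ?_⟩
  rw [hfg, LinearEquiv.ker_comp]

theorem HasRes.prod {V N N' : FGMod S} (h : HasRes V N) (h' : HasRes V N') :
    HasRes V (prodMod N N') := by
  obtain ⟨V1, V0, h1, h0, f, g, hf, hg, hfg⟩ := h
  obtain ⟨V1', V0', h1', h0', f', g', hf', hg', hfg'⟩ := h'
  rw [mem_addOf_singleton] at h1 h0 h1' h0'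
  refine ⟨prodMod V1 V1', prodMod V0 V0', mem_addOf_singleton.2 (h1.prod h1'),
    mem_addOf_singleton.2 (h0.prod h0'), f.prodMap f', g.prodMap g', hf.prodMap hf',
    hg.prodMap hg', ?_⟩
  have : LinearMap.range (f.prodMap f') = LinearMap.ker (g.prodMap g') := by
    rw [LinearMap.range_prodMap, LinearMap.ker_prodMap, hfg, hfg']
  exact this

theorem HasRes.mono {V V' N : FGMod S} (h : HasRes V N) (hV : IsRetract S V'.carrier V.carrier) :
    HasRes V' N := by
  obtain ⟨V1, V0, h1, h0, hs⟩ := h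
  rw [mem_addOf_singleton] at h1 h0
  exact ⟨V1, V0, mem_addOf_singleton.2 (hV.trans h1), mem_addOf_singleton.2 (hV.trans h0), hs⟩

theorem HasRes.of_isRetract {V N : FGMod S} (h : IsRetract S V.carrier N.carrier) :
    HasRes V N := by
  refine ⟨⟨PUnit⟩, N, mem_addOf_singleton.2 ⟨0, Fin.elim0, Fin.elim0, fun x => rfl⟩,
    mem_addOf_singleton.2 h, 0, .id, fun _ _ _ => rfl, surjective_id, ?_⟩
  rw [LinearMap.range_zero, LinearMap.ker_id]

theorem Corner.hasRes_res (C : Corner S R) {V N : FGMod R} (h : HasRes V N) :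
    HasRes (C.res V) (C.res N) := by
  obtain ⟨V1, V0, h1, h0, f, g, hf, hg, hfg⟩ := h
  rw [mem_addOf_singleton] at h1 h0
  exact ⟨C.res V1, C.res V0, mem_addOf_singleton.2 (C.isRetract_res h1),
    mem_addOf_singleton.2 (C.isRetract_res h0), C.resMap f, C.resMap g, hf, hg,
    SetLike.ext fun x => SetLike.ext_iff.1 hfg x⟩

/-- Stable equivalence: `M ⊕ Q ≅ N ⊕ Q'` for finitely generated projectives `Q`, `Q'`. -/
def StablyEquiv (R : Type u) [Ring R] (M N : Type u) [AddCommGroup M] [Module R M]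
    [AddCommGroup N] [Module R N] : Prop :=
  ∃ Q Q' : FGMod R, IsRetract R R Q.carrier ∧ IsRetract R R Q'.carrier ∧
    Nonempty ((M × Q.carrier) ≃ₗ[R] (N × Q'.carrier))

theorem HasRes.of_stablyEquiv {V M N : FGMod R} (h : HasRes V M)
    (e : StablyEquiv R M.carrier N.carrier) (hV : IsRetract R V.carrier R) : HasRes V N := by
  obtain ⟨V1, V0, h1, h0, f, g, hf, hg, hfg⟩ := h
  obtain ⟨Q, Q', hQ, hQ', ⟨e⟩⟩ := e
  rw [mem_addOf_singleton] at h1 h0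
  let w : (V0.carrier × Q.carrier) →ₗ[R] (N.carrier × Q'.carrier) :=
    e.toLinearMap ∘ₗ g.prodMap .id
  have hw : Surjective w := e.surjective.comp (hg.prodMap surjective_id)
  have hwf : ∀ v, w (f v, 0) = 0 := fun v => by
    have : g (f v) = 0 := LinearMap.mem_ker.1 (hfg ▸ ⟨v, rfl⟩)
    simp [w, this]
  have hwk : ∀ x, w x = 0 → ∃ v, (f v, 0) = x := fun x hx => by
    have h2 : (g x.1, x.2) = 0 := e.injective (hx.trans (map_zero e).symm)
    obtain ⟨v, hv⟩ : x.1 ∈ LinearMap.range f := hfg ▸ LinearMap.mem_ker.2 (congrArg Prod.fst h2)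
    exact ⟨v, Prod.ext hv (congrArg Prod.snd h2).symm⟩
  have := hQ'.projective
  obtain ⟨s, hs⟩ := Module.projective_lifting_property w (.inr R N.carrier Q'.carrier) hw
  have hs : ∀ q, w (s q) = (0, q) := fun q => LinearMap.congr_fun hs q
  refine ⟨prodMod V1 Q', prodMod V0 Q, mem_addOf_singleton.2 (h1.prod (hV.trans hQ')),
    mem_addOf_singleton.2 (h0.prod (hV.trans hQ)),
    ((LinearMap.inl R _ _ ∘ₗ f).coprod s : (V1.carrier × Q'.carrier) →ₗ[R] _),
    (LinearMap.fst R _ _ ∘ₗ w : (V0.carrier × Q.carrier) →ₗ[R] N.carrier), ?_,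
    Prod.fst_surjective.comp hw, ?_⟩
  · refine (injective_iff_map_eq_zero _).2 fun (x : V1.carrier × Q'.carrier) hx => ?_
    have hx : (f x.1, 0) + s x.2 = 0 := hx
    have h2 := congrArg w hx
    rw [map_add, hwf, hs, map_zero, zero_add] at h2
    have h3 : x.2 = 0 := congrArg Prod.snd h2
    rw [h3, map_zero, add_zero] at hx
    have h4 : f x.1 = 0 := congrArg Prod.fst hx
    exact Prod.ext (hf (h4.trans (map_zero f).symm)) h3
  · refine SetLike.ext fun (x : V0.carrier × Q.carrier) => ⟨?_, fun hx => ?_⟩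
    · rintro ⟨(y : V1.carrier × Q'.carrier), rfl⟩
      change (w ((f y.1, 0) + s y.2)).1 = 0
      rw [map_add, hwf, hs, zero_add]
    · have hx : (w x).1 = 0 := hx
      obtain ⟨v, hv⟩ := hwk (x - s (w x).2) (by
        rw [map_sub, hs, sub_eq_zero]
        exact Prod.ext hx rfl)
      refine ⟨((v, (w x).2) : V1.carrier × Q'.carrier), ?_⟩
      change (f v, 0) + s (w x).2 = x
      rw [hv, sub_add_cancel]

theorem StablyEquiv.kernel {K P X N F Y : Type u} [AddCommGroup K] [Module R K]
    [AddCommGroup P] [Module R P] [AddCommGroup X] [Module R X]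
    [AddCommGroup N] [Module R N] [AddCommGroup F] [Module R F] [AddCommGroup Y] [Module R Y]
    (hP : IsRetract R R P) (hF : IsRetract R R F)
    [Module.Finite R P] [Module.Finite R F]
    {i : K →ₗ[R] P} {f : P →ₗ[R] X} (hi : Injective i) (hf : Surjective f)
    (hif : LinearMap.range i = LinearMap.ker f)
    {j : N →ₗ[R] F} {g : F →ₗ[R] Y} (hj : Injective j) (hg : Surjective g)
    (hjg : LinearMap.range j = LinearMap.ker g) (h : StablyEquiv R X Y) :
    StablyEquiv R K N := by
  obtain ⟨Q, Q', hQ, hQ', ⟨e⟩⟩ := h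
  have p1 : Module.Projective R (P × Q.carrier) := (hP.prod hQ).projective
  have p2 : Module.Projective R (F × Q'.carrier) := (hF.prod hQ').projective
  refine ⟨⟨F × Q'.carrier⟩, ⟨P × Q.carrier⟩, hF.prod hQ', hP.prod hQ, ?_⟩
  refine schanuel (i := .inl R P Q.carrier ∘ₗ i) (f := e.toLinearMap ∘ₗ f.prodMap .id)
    (j := .inl R F Q'.carrier ∘ₗ j) (g := g.prodMap .id)
    (LinearMap.inl_injective.comp hi) (e.surjective.comp (hf.prodMap surjective_id)) ?_
    (LinearMap.inl_injective.comp hj) (hg.prodMap surjective_id) ?_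
  · rw [LinearEquiv.ker_comp, LinearMap.ker_prodMap, LinearMap.range_comp, hif, LinearMap.ker_id,
      Submodule.map_inl]
  · rw [LinearMap.ker_prodMap, LinearMap.range_comp, hjg, LinearMap.ker_id,
      Submodule.map_inl]

end Resolutions

section Main

variable {k : Type u} [Field k] {S R : Type u} [Ring S] [Algebra k S] [Module.Finite k S]
  [Ring R]

theorem Corner.exists_stablyEquiv_fix_syz_iterate [IsArtinianRing S] [IsNoetherianRing S]
    (C : Corner S R) (hC : ∀ s, C.sec 1 * s = C.sec (C.toHom s))
    (hR : ∀ N : FGMod R, ∃ (n : ℕ) (f : N.carrier →ₗ[R] (Fin n → R)), Injective f) (m : ℕ) :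
    ∀ N : FGMod R, ∃ Z : FGMod S, StablyEquiv R (C.fix (syz^[m] Z).carrier) N.carrier := by
  have hCc : ∀ M : FGMod S, C.Compatible M.carrier := fun M s x => by rw [← mul_smul, hC]
  induction m with
  | zero =>
    intro N
    exact ⟨C.res N, ⟨PUnit⟩, ⟨PUnit⟩, ⟨0, Fin.elim0, Fin.elim0, fun x => rfl⟩,
      ⟨0, Fin.elim0, Fin.elim0, fun x => rfl⟩, ⟨(C.fixRes N).prodCongr (.refl R _)⟩⟩
  | succ m ih =>
    intro N
    obtain ⟨n, j, hj⟩ := hR N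
    obtain ⟨Z, hZ⟩ := ih ⟨(Fin n → R) ⧸ LinearMap.range j⟩
    obtain ⟨P, f, hf, ⟨e⟩⟩ := isSyzygyOf_syz (syz^[m] Z)
    have hP : Module.Projective S P.carrier := hf.1
    refine ⟨Z, ?_⟩
    rw [iterate_succ_apply']
    have hPR : IsRetract R R (C.fixMod P (hCc P)).carrier :=
      (IsRetract.of_equiv (C.fixSelf hC)).trans (C.isRetract_fix .of_projective)
    have hi : Injective ((LinearMap.ker f).subtype ∘ₗ e.toLinearMap) :=
      (LinearMap.ker f).subtype_injective.comp e.injective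
    have : Module.Finite R (C.fix P.carrier) := (C.fixMod P (hCc P)).isFinite
    exact StablyEquiv.kernel hPR (IsRetract.pi n) (C.injective_fixMap hi)
      (C.surjective_fixMap hf.2.1)
      (C.range_fixMap hi (by
        rw [LinearMap.range_comp, LinearEquiv.range, Submodule.map_top, Submodule.range_subtype]))
      hj (Submodule.mkQ_surjective _) (Submodule.ker_mkQ _).symm hZ

/-- If all first syzygies over `S` split into modules over the corner `R` and over two copies of
the ground field, and finitely generated `R`-modules embed in free modules, then the
Igusa-Todorov property passes from `m`-th syzygies to first syzygies. -/
theorem exists_isITClass_one (C : Corner S R) (hC : ∀ s, C.sec 1 * s = C.sec (C.toHom s))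
    (D : Fin 2 → Corner S k) (G : Set S) (hG : ∀ g ∈ G, ∀ s, ∃ c : k, g * s = c • g)
    (hD : ∀ w s, (D w).sec 1 * s - (D w).sec ((D w).toHom s) ∈ Submodule.span k G)
    (hsum : C.sec 1 + ((D 0).sec 1 + (D 1).sec 1) = 1)
    (hCD : ∀ w, C.sec 1 * (D w).sec 1 = 0) (hDC : ∀ w, (D w).sec 1 * C.sec 1 = 0)
    (hDD : ∀ w w', w ≠ w' → (D w).sec 1 * (D w').sec 1 = 0)
    (hR : ∀ N : FGMod R, ∃ (n : ℕ) (f : N.carrier →ₗ[R] (Fin n → R)), Injective f)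
    (h : ∃ (m : ℕ) (W : FGMod S), IsITClass m W Set.univ) :
    ∃ W : FGMod S, IsITClass 1 W Set.univ := by
  have : IsArtinianRing S := IsArtinianRing.of_finite k S
  have : IsNoetherianRing S := IsNoetherianRing.of_finite k S
  have hCc : ∀ M : FGMod S, C.Compatible M.carrier := fun M s x => by rw [← mul_smul, hC]
  obtain ⟨m, W, hW⟩ := h
  let V : FGMod R := prodMod (C.fixMod W (hCc W)) ⟨R⟩
  have hV : ∀ N : FGMod R, HasRes V N := by
    intro N
    obtain ⟨Z, hZ⟩ := C.exists_stablyEquiv_fix_syz_iterate hC hR m N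
    obtain ⟨V1, V0, h1, h0, f, g, hf, hg, hfg⟩ := hW Z trivial
    rw [mem_addOf_singleton] at h1 h0
    have hr : HasRes (C.fixMod W (hCc W)) (C.fixMod (syz^[m] Z) (hCc _)) :=
      ⟨C.fixMod V1 (hCc _), C.fixMod V0 (hCc _), mem_addOf_singleton.2 (C.isRetract_fix h1),
        mem_addOf_singleton.2 (C.isRetract_fix h0), C.fixMap f, C.fixMap g, C.injective_fixMap hf,
        C.surjective_fixMap hg, C.range_fixMap hf hfg⟩
    have hVR : IsRetract R (C.fix W.carrier × R) R := .snd
    exact (hr.mono (V' := V) .fst).of_stablyEquiv hZ hVR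
  let T : Fin 2 → FGMod S := fun w => (D w).res (.regular k)
  refine ⟨prodMod (C.res V) (prodMod (T 0) (T 1)), fun M _ => ?_⟩
  change HasRes _ (syz M)
  obtain ⟨P, f, hf, ⟨e⟩⟩ := isSyzygyOf_syz M
  have hGK : ∀ g ∈ G, ∀ x : (syz M).carrier, g • x = 0 := by
    intro g hg x
    apply e.injective
    apply Subtype.ext
    rw [map_smul, map_zero]
    exact IsProjCover.smul_eq_zero (k := k) hf (hG g hg) (e x).2
  have hspan : ∀ a ∈ Submodule.span k G, ∀ x : (syz M).carrier, a • x = 0 := by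
    intro a ha x
    induction ha using Submodule.span_induction with
    | mem a ha => exact hGK a ha x
    | zero => exact zero_smul _ _
    | add a b _ _ iha ihb => rw [add_smul, iha, ihb, add_zero]
    | smul c a _ iha => rw [Algebra.smul_def, mul_smul, iha, smul_zero]
  have hDc : ∀ w, (D w).Compatible (syz M).carrier := fun w s x => by
    rw [← mul_smul, ← sub_eq_zero, ← sub_smul]
    exact hspan _ (hD w s) x
  have hT : ∀ w, HasRes (T w) ((D w).res ((D w).fixMod (syz M) (hDc w))) := fun w =>
    .of_isRetract ((D w).isRetract_res (V := .regular k) .of_projective)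
  have r0 := (C.hasRes_res (hV (C.fixMod (syz M) (hCc _)))).mono
    (V' := prodMod (C.res V) (prodMod (T 0) (T 1))) .fst
  have r1 := (hT 0).mono (V' := prodMod (C.res V) (prodMod (T 0) (T 1)))
    (IsRetract.snd.trans .fst)
  have r2 := (hT 1).mono (V' := prodMod (C.res V) (prodMod (T 0) (T 1)))
    (IsRetract.snd.trans .snd)
  refine (r0.prod (r1.prod r2)).of_equiv (LinearEquiv.symm (LinearEquiv.ofBijective
    ((C.proj _ (hCc _)).prod (((D 0).proj _ (hDc 0)).prod ((D 1).proj _ (hDc 1)))) ⟨?_, ?_⟩))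
  · refine (injective_iff_map_eq_zero _).2 fun x hx => ?_
    have h0 : C.sec 1 • x = 0 := congrArg (fun y => (Subtype.val (Prod.fst y))) hx
    have h1 : (D 0).sec 1 • x = 0 := congrArg (fun y => (Subtype.val (Prod.fst (Prod.snd y)))) hx
    have h2 : (D 1).sec 1 • x = 0 := congrArg (fun y => (Subtype.val (Prod.snd (Prod.snd y)))) hx
    rw [← one_smul S x, ← hsum, add_smul, add_smul, h0, h1, h2, add_zero, add_zero]
  · rintro ⟨⟨x, hx⟩, ⟨⟨y, hy⟩, ⟨z, hz⟩⟩⟩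
    rw [Corner.mem_fix] at hx hy hz
    refine ⟨x + (y + z), Prod.ext (Subtype.ext ?_) (Prod.ext (Subtype.ext ?_) (Subtype.ext ?_))⟩
    · change C.sec 1 • (x + (y + z)) = x
      rw [← hy, ← hz, smul_add, smul_add, ← mul_smul, ← mul_smul, hCD, hCD, hx]
      simp
    · change (D 0).sec 1 • (x + (y + z)) = y
      rw [← hx, ← hz, smul_add, smul_add, ← mul_smul, ← mul_smul, hDC, hDD _ _ (by decide), hy]
      simp
    · change (D 1).sec 1 • (x + (y + z)) = z
      rw [← hx, ← hy, smul_add, smul_add, ← mul_smul, ← mul_smul, hDC, hDD _ _ (by decide), hz]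
      simp

end Main

section PathAlgebra

variable {k V E : Type u} [Field k] [Fintype V] [DecidableEq V] (s t : E → V)

theorem vtx_mul_vtx (v w : V) :
    vtx k s t v * vtx k s t w = if v = w then vtx k s t v else 0 := by
  have := RingQuot.mkRingHom_rel (PathRel.vtx (k := k) (s := s) (t := t) v w)
  rw [map_mul] at this
  refine this.trans ?_
  split_ifs
  · rfl
  · exact map_zero _

theorem vtx_mul_vtx_of_ne {v w : V} (h : v ≠ w) : vtx k s t v * vtx k s t w = 0 := by
  rw [vtx_mul_vtx, if_neg h]

variable (k) in
theorem sum_vtx : ∑ v, vtx k s t v = 1 := by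
  have := RingQuot.mkRingHom_rel (PathRel.one (k := k) (s := s) (t := t))
  rwa [map_sum, map_one] at this

theorem vtx_mul_arr (e : E) : vtx k s t (s e) * arr k s t e = arr k s t e := by
  have := RingQuot.mkRingHom_rel (PathRel.src (k := k) (s := s) (t := t) e)
  rwa [map_mul] at this

theorem arr_mul_vtx (e : E) : arr k s t e * vtx k s t (t e) = arr k s t e := by
  have := RingQuot.mkRingHom_rel (PathRel.tgt (k := k) (s := s) (t := t) e)
  rwa [map_mul] at this

theorem vtx_mul_arr_of_ne {v : V} {e : E} (h : v ≠ s e) : vtx k s t v * arr k s t e = 0 := by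
  rw [← vtx_mul_arr, ← mul_assoc, vtx_mul_vtx_of_ne s t h, zero_mul]

theorem arr_mul_vtx_of_ne {v : V} {e : E} (h : t e ≠ v) : arr k s t e * vtx k s t v = 0 := by
  rw [← arr_mul_vtx, mul_assoc, vtx_mul_vtx_of_ne s t h, mul_zero]

theorem arr_mul_arr_of_ne {e e' : E} (h : t e ≠ s e') : arr k s t e * arr k s t e' = 0 := by
  rw [← arr_mul_vtx, mul_assoc, vtx_mul_arr_of_ne s t h, mul_zero]

variable (k) in
theorem adjoin_vtx_arr :
    Algebra.adjoin k (Set.range (vtx k s t) ∪ Set.range (arr k s t)) = ⊤ := by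
  have h := congrArg (Subalgebra.map (RingQuot.mkAlgHom k (PathRel k V E s t)))
    (FreeAlgebra.adjoin_range_ι k (V ⊕ E))
  rw [AlgHom.map_adjoin, Algebra.map_top,
    (AlgHom.range_eq_top _).2 (RingQuot.mkAlgHom_surjective k _)] at h
  rw [← top_le_iff, ← h]
  refine Algebra.adjoin_mono ?_
  rintro _ ⟨_, ⟨v | e, rfl⟩, rfl⟩
  · exact Or.inl ⟨v, by rw [vtx, ← RingQuot.mkAlgHom_coe k]; rfl⟩
  · exact Or.inr ⟨e, by rw [arr, ← RingQuot.mkAlgHom_coe k]; rfl⟩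

/-- The universal property of the path algebra. -/
theorem exists_pathAlg_algHom {X : Type u} [Ring X] [Algebra k X] (a : V → X) (b : E → X)
    (ha : ∀ v w, a v * a w = if v = w then a v else 0) (ha1 : ∑ v, a v = 1)
    (hs : ∀ e, a (s e) * b e = b e) (ht : ∀ e, b e * a (t e) = b e) :
    ∃ f : PathAlg k V E s t →ₐ[k] X,
      (∀ v, f (vtx k s t v) = a v) ∧ ∀ e, f (arr k s t e) = b e := by
  let F : FreeAlgebra k (V ⊕ E) →ₐ[k] X := FreeAlgebra.lift k (Sum.elim a b)
  have hFa : ∀ v, F (FreeAlgebra.ι k (Sum.inl v)) = a v := fun v =>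
    FreeAlgebra.lift_ι_apply _ _
  have hFb : ∀ e, F (FreeAlgebra.ι k (Sum.inr e)) = b e := fun e =>
    FreeAlgebra.lift_ι_apply _ _
  have hF : ∀ ⦃x y⦄, PathRel k V E s t x y → F x = F y := by
    intro x y h
    cases h with
    | vtx v w =>
      rw [map_mul, hFa, hFa, ha]
      split_ifs
      · rw [hFa]
      · rw [map_zero]
    | one => simp only [map_sum, hFa, ha1, map_one]
    | src e => rw [map_mul, hFa, hFb, hs]
    | tgt e => rw [map_mul, hFa, hFb, ht]
  refine ⟨RingQuot.liftAlgHom k ⟨F, hF⟩, fun v => ?_, fun e => ?_⟩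
  · rw [vtx, ← RingQuot.mkAlgHom_coe k]
    exact (RingQuot.liftAlgHom_mkAlgHom_apply k F hF _).trans (hFa v)
  · rw [arr, ← RingQuot.mkAlgHom_coe k]
    exact (RingQuot.liftAlgHom_mkAlgHom_apply k F hF _).trans (hFb e)

/-- Non-unital homomorphisms out of a path algebra agree if they agree on vertices and arrows. -/
theorem nonUnitalAlgHom_pathAlg_ext {X : Type u} [Ring X] [Algebra k X]
    {f g : PathAlg k V E s t →ₙₐ[k] X} (hv : ∀ v, f (vtx k s t v) = g (vtx k s t v))
    (he : ∀ e, f (arr k s t e) = g (arr k s t e)) : f = g := by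
  ext x
  have hx : x ∈ Algebra.adjoin k (Set.range (vtx k s t) ∪ Set.range (arr k s t)) :=
    adjoin_vtx_arr k s t ▸ Algebra.mem_top
  induction hx using Algebra.adjoin_induction with
  | mem x hx =>
    obtain ⟨v, rfl⟩ | ⟨e, rfl⟩ := hx
    exacts [hv v, he e]
  | algebraMap r =>
    rw [Algebra.algebraMap_eq_smul_one, map_smul, map_smul, ← sum_vtx k s t, map_sum, map_sum]
    simp only [hv]
  | add x y _ _ hx hy => rw [map_add, map_add, hx, hy]
  | mul x y _ _ hx hy => rw [map_mul, map_mul, hx, hy]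

end PathAlgebra

section Quotient

variable {k X Y : Type u} [Field k] [Ring X] [Algebra k X] [Ring Y] [Algebra k Y]

theorem exists_quotient_algHom (I : TwoSidedIdeal X) (f : X →ₐ[k] Y) (h : ∀ x ∈ I, f x = 0) :
    ∃ g : I.ringCon.Quotient →ₐ[k] Y, ∀ x, g (I.ringCon.mkₐ k x) = f x :=
  ⟨I.ringCon.liftₐ f fun {x y} hxy => sub_eq_zero.1 ((map_sub f x y).symm.trans
    (h _ ((I.rel_iff x y).1 hxy))), fun _ => rfl⟩

theorem quotient_mk_eq_zero {I : TwoSidedIdeal X} {x : X} :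
    I.ringCon.mkₐ k x = 0 ↔ x ∈ I := by
  rw [I.mem_iff]
  exact I.ringCon.eq

theorem exists_quotient_nonUnitalAlgHom (I : TwoSidedIdeal X) (f : X →ₙₐ[k] Y)
    (h : ∀ x ∈ I, f x = 0) :
    ∃ g : I.ringCon.Quotient →ₙₐ[k] Y, ∀ x, g (I.ringCon.mkₐ k x) = f x := by
  have hf : ∀ x y, I.ringCon x y → f x = f y := fun x y hxy =>
    sub_eq_zero.1 ((map_sub f x y).symm.trans (h _ ((I.rel_iff x y).1 hxy)))
  exact ⟨
    { toFun := fun x => Quotient.liftOn' x f hf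
      map_smul' := fun c x => Quotient.inductionOn' x fun x => map_smul f c x
      map_zero' := map_zero f
      map_add' := fun x y => Quotient.inductionOn₂' x y fun x y => map_add f x y
      map_mul' := fun x y => Quotient.inductionOn₂' x y fun x y => map_mul f x y },
    fun _ => rfl⟩

end Quotient

section Corners

variable {k : Type u} [Field k] {A B : Type u} [Ring A] [Algebra k A] [Ring B] [Algebra k B]

/-- The corner of opposite algebras defined by a homomorphism `ρ` with section `j`. -/
def Corner.ofAlgHom (ρ : A →ₐ[k] B) (j : B →ₙₐ[k] A) (h : ∀ b, ρ (j b) = b) :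
    Corner Aᵐᵒᵖ Bᵐᵒᵖ where
  toHom := ρ.toRingHom.op
  sec := (j : B →+ A).mulOp
  sec_mul a b := congrArg MulOpposite.op (map_mul j b.unop a.unop)
  toHom_sec a := congrArg MulOpposite.op (h a.unop)

/-- The corner defined by a character `χ` and an idempotent `e` with `χ e = 1`. -/
def Corner.ofCharacter (χ : A →ₐ[k] k) (e : A) (he : e * e = e) (h : χ e = 1) :
    Corner Aᵐᵒᵖ k where
  toHom := χ.toRingHom.fromOpposite fun _ _ => mul_comm _ _
  sec :=
    { toFun := fun c => MulOpposite.op (c • e)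
      map_zero' := by rw [zero_smul]; rfl
      map_add' := fun a b => by rw [add_smul]; rfl }
  sec_mul a b := MulOpposite.unop_injective (by
    change (a * b) • e = (b • e) * (a • e)
    rw [smul_mul_smul_comm, he, mul_comm])
  toHom_sec a := by
    change χ (a • e) = a
    rw [map_smul, h, smul_eq_mul, mul_one]

theorem injective_op (h : Module.Injective Bᵐᵒᵖ B) : Module.Injective Bᵐᵒᵖ Bᵐᵒᵖ := by
  let e : B ≃ₗ[Bᵐᵒᵖ] Bᵐᵒᵖ :=
    { toFun := MulOpposite.op
      invFun := MulOpposite.unop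
      map_add' := fun _ _ => rfl
      map_smul' := fun _ _ => rfl
      left_inv := fun _ => rfl
      right_inv := fun _ => rfl }
  refine ⟨fun X Y _ _ _ _ f hf g => ?_⟩
  obtain ⟨h, hh⟩ := h.out f hf (e.symm.toLinearMap ∘ₗ g)
  exact ⟨e.toLinearMap ∘ₗ h, fun x => by simp [hh]⟩

/-- Criterion for the Igusa-Todorov property to descend to first syzygies in terms of generators
of the algebra. -/
theorem exists_isITClass_one_of_adjoin {ι : Type u} [Finite ι] [Module.Finite k B]
    (hB : Module.Injective Bᵐᵒᵖ B)
    (ρ : A →ₐ[k] B) (j : B →ₙₐ[k] A) (χ : Fin 2 → A →ₐ[k] k) (e : Fin 2 → A) (g : ι → A)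
    (hρj : ∀ b, ρ (j b) = b) (hχe : ∀ w, χ w (e w) = 1) (hone : j 1 + (e 0 + e 1) = 1)
    (hje : ∀ w, j 1 * e w = 0) (hej : ∀ w, e w * j 1 = 0)
    (hee : ∀ w w', e w * e w' = if w = w' then e w else 0)
    (X : Set A) (hX : Algebra.adjoin k X = ⊤)
    (hXj : ∀ x ∈ X, x * j 1 = j (ρ x))
    (hXe : ∀ x ∈ X, ∀ w, x * e w - χ w x • e w ∈ Submodule.span k (Set.range g))
    (hXg : ∀ x ∈ X, ∀ i, ∃ c : k, x * g i = c • g i)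
    (h : ∃ (m : ℕ) (W : FGMod Aᵐᵒᵖ), IsITClass m W Set.univ) :
    ∃ W : FGMod Aᵐᵒᵖ, IsITClass 1 W Set.univ := by
  have hind : ∀ {p : A → Prop}, (∀ x ∈ X, p x) → (∀ r : k, p (algebraMap k A r)) →
      (∀ x y, p x → p y → p (x + y)) → (∀ x y, p x → p y → p (x * y)) → ∀ x, p x := by
    intro p h1 h2 h3 h4 x
    have hx : x ∈ Algebra.adjoin k X := hX ▸ Algebra.mem_top
    induction hx using Algebra.adjoin_induction with
    | mem x hx => exact h1 x hx
    | algebraMap r => exact h2 r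
    | add x y _ _ hx hy => exact h3 x y hx hy
    | mul x y _ _ hx hy => exact h4 x y hx hy
  have hAg : ∀ a i, ∃ c : k, a * g i = c • g i := by
    refine hind hXg (fun r i => ⟨r, (Algebra.smul_def r (g i)).symm⟩) ?_ ?_
    · intro x y hx hy i
      obtain ⟨c, hc⟩ := hx i
      obtain ⟨d, hd⟩ := hy i
      exact ⟨c + d, by rw [add_mul, hc, hd, add_smul]⟩
    · intro x y hx hy i
      obtain ⟨c, hc⟩ := hx i
      obtain ⟨d, hd⟩ := hy i
      exact ⟨d * c, by rw [mul_assoc, hd, mul_smul_comm, hc, smul_smul]⟩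
  have hspan : ∀ a, ∀ b ∈ Submodule.span k (Set.range g),
      a * b ∈ Submodule.span k (Set.range g) := by
    intro a b hb
    induction hb using Submodule.span_induction with
    | mem x hx =>
      obtain ⟨i, rfl⟩ := hx
      obtain ⟨c, hc⟩ := hAg a i
      rw [hc]
      exact Submodule.smul_mem _ _ (Submodule.subset_span ⟨i, rfl⟩)
    | zero => rw [mul_zero]; exact zero_mem _
    | add x y _ _ hx hy => rw [mul_add]; exact add_mem hx hy
    | smul c x _ hx => rw [mul_smul_comm]; exact Submodule.smul_mem _ _ hx
  have hAj : ∀ a, a * j 1 = j (ρ a) := by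
    refine hind hXj (fun r => ?_) ?_ ?_
    · rw [AlgHom.commutes, Algebra.algebraMap_eq_smul_one, Algebra.algebraMap_eq_smul_one,
        map_smul, smul_mul_assoc, one_mul]
    · intro x y hx hy
      rw [add_mul, hx, hy, map_add, map_add]
    · intro x y hx hy
      rw [mul_assoc, hy, map_mul, map_mul, ← hx, mul_assoc, ← map_mul, one_mul]
  have hAe : ∀ a w, a * e w - χ w a • e w ∈ Submodule.span k (Set.range g) := by
    refine hind hXe (fun r w => ?_) ?_ ?_
    · rw [AlgHom.commutes, ← Algebra.smul_def, Algebra.algebraMap_self, RingHom.id_apply, sub_self]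
      exact zero_mem _
    · intro x y hx hy w
      have := add_mem (hx w) (hy w)
      rwa [← add_sub_add_comm, ← add_mul, ← add_smul, ← map_add] at this
    · intro x y hx hy w
      have := add_mem (hspan x _ (hy w)) (Submodule.smul_mem _ (χ w y) (hx w))
      rwa [mul_sub, smul_sub, mul_smul_comm, sub_add_sub_cancel, smul_smul, ← mul_assoc,
        mul_comm (χ w y), ← map_mul] at this
  have hfin : Module.Finite k A := by
    have : Submodule.FG (LinearMap.range (j : B →ₗ[k] A) ⊔ Submodule.span k (Set.range e) ⊔
        Submodule.span k (Set.range g)) :=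
      ((Submodule.FG.of_finite.sup (Submodule.fg_span (Set.finite_range e))).sup
        (Submodule.fg_span (Set.finite_range g)))
    refine ⟨?_⟩
    convert this
    rw [eq_comm, eq_top_iff]
    intro a _
    have hw : ∀ w, a * e w ∈ LinearMap.range (j : B →ₗ[k] A) ⊔ Submodule.span k (Set.range e) ⊔
        Submodule.span k (Set.range g) := by
      intro w
      rw [← sub_add_cancel (a * e w) (χ w a • e w), add_comm]
      exact Submodule.add_mem_sup (Submodule.mem_sup_right
        (Submodule.smul_mem _ _ (Submodule.subset_span ⟨w, rfl⟩))) (hAe a w)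
    rw [← mul_one a, ← hone, mul_add, mul_add, hAj]
    exact add_mem (Submodule.mem_sup_left (Submodule.mem_sup_left ⟨ρ a, rfl⟩))
      (add_mem (hw 0) (hw 1))
  have he : ∀ w, e w * e w = e w := fun w => by rw [hee, if_pos rfl]
  have := injective_op hB
  have : IsArtinianRing Bᵐᵒᵖ := IsArtinianRing.of_finite k Bᵐᵒᵖ
  have : IsNoetherian Bᵐᵒᵖᵐᵒᵖ Bᵐᵒᵖ := isNoetherian_of_tower k inferInstance
  refine exists_isITClass_one (k := k) (Corner.ofAlgHom ρ j hρj)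
    (fun a => congrArg MulOpposite.op (hAj a.unop))
    (fun w => Corner.ofCharacter (χ w) (e w) (he w) (hχe w))
    (MulOpposite.op '' Set.range g) ?_ ?_ ?_ ?_ ?_ ?_ (fun N => exists_injective_pi N.carrier) h
  · rintro _ ⟨_, ⟨i, rfl⟩, rfl⟩ a
    obtain ⟨c, hc⟩ := hAg a.unop i
    exact ⟨c, congrArg MulOpposite.op hc⟩
  · intro w a
    have := Submodule.mem_map_of_mem (f := (MulOpposite.opLinearEquiv k : A ≃ₗ[k] Aᵐᵒᵖ).toLinearMap)
      (hAe a.unop w)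
    rw [Submodule.map_span] at this
    refine Eq.mp (congrArg (· ∈ Submodule.span k (MulOpposite.op '' Set.range g)) ?_) this
    apply MulOpposite.unop_injective
    symm
    change a.unop * ((1 : k) • e w) - _ • e w = _
    rw [one_smul]
    rfl
  · apply MulOpposite.unop_injective
    change j 1 + ((1 : k) • e 0 + (1 : k) • e 1) = 1
    rw [one_smul, one_smul, hone]
  · intro w
    apply MulOpposite.unop_injective
    change ((1 : k) • e w) * j 1 = 0
    rw [one_smul, hej]
  · intro w
    apply MulOpposite.unop_injective
    change j 1 * ((1 : k) • e w) = 0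
    rw [one_smul, hje]
  · intro w w' hw
    apply MulOpposite.unop_injective
    change ((1 : k) • e w') * ((1 : k) • e w) = 0
    rw [one_smul, one_smul, hee, if_neg hw.symm]

end Corners

section Example

variable {k V E : Type u} [Field k] [Fintype V] [DecidableEq V] {s t : E → V}
  {IB : TwoSidedIdeal (PathAlg k V E s t)}
  {ι : PathAlg k V E s t →ₙₐ[k]
    PathAlg k (GammaV V) (GammaE V E) (gammaSrc s) (gammaTgt t)}

theorem subset_exampleIdeal :
    ((⇑ι '' (IB : Set (PathAlg k V E s t))) ∪
      {x | ∃ p q : Fin 2 × Fin 2,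
        x = arr k (gammaSrc s) (gammaTgt t) (Sum.inr (Sum.inl p)) *
            arr k (gammaSrc s) (gammaTgt t) (Sum.inr (Sum.inl q))} ∪
      {x | ∃ (i : V) (lam : PathAlg k (GammaV V) (GammaE V E) (gammaSrc s) (gammaTgt t)),
        IsArrowMonomial (gammaSrc s) (gammaTgt t) lam ∧
          (x = lam * arr k (gammaSrc s) (gammaTgt t) (Sum.inr (Sum.inr i)) ∨
            x = arr k (gammaSrc s) (gammaTgt t) (Sum.inr (Sum.inr i)) * lam)}) ⊆
      (exampleIdeal k V E s t IB ι : Set _) :=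
  TwoSidedIdeal.span_le.1 le_rfl

theorem eq_zero_of_mem_exampleIdeal {Y : Type u} [Ring Y] [Algebra k Y]
    (f : PathAlg k (GammaV V) (GammaE V E) (gammaSrc s) (gammaTgt t) →ₐ[k] Y)
    (hι : ∀ x ∈ IB, f (ι x) = 0)
    (hf : ∀ i, f (arr k (gammaSrc s) (gammaTgt t) (Sum.inr i)) = 0)
    {x : PathAlg k (GammaV V) (GammaE V E) (gammaSrc s) (gammaTgt t)}
    (hx : x ∈ exampleIdeal k V E s t IB ι) : f x = 0 := by
  have : exampleIdeal k V E s t IB ι ≤ TwoSidedIdeal.ker f := by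
    refine TwoSidedIdeal.span_le.2 ?_
    rintro _ ((⟨x, hx, rfl⟩ | ⟨p, q, rfl⟩) | ⟨i, lam, -, rfl | rfl⟩)
    · exact (TwoSidedIdeal.mem_ker f).2 (hι x hx)
    · exact (TwoSidedIdeal.mem_ker f).2 (by rw [map_mul, hf, zero_mul])
    · exact (TwoSidedIdeal.mem_ker f).2 (by rw [map_mul, hf, mul_zero])
    · exact (TwoSidedIdeal.mem_ker f).2 (by rw [map_mul, hf, zero_mul])
  exact (TwoSidedIdeal.mem_ker f).1 (this hx)

theorem isArrowMonomial_arr (e : E) : IsArrowMonomial s t (arr k s t e) :=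
  ⟨0, fun _ => e, by simp⟩

theorem arr_mul_arr_mem_exampleIdeal (e : GammaE V E) (i : (Fin 2 × Fin 2) ⊕ V) :
    arr k (gammaSrc s) (gammaTgt t) e * arr k (gammaSrc s) (gammaTgt t) (Sum.inr i) ∈
      exampleIdeal k V E s t IB ι := by
  obtain q | v := i
  · obtain e | p | w := e
    · rw [arr_mul_arr_of_ne]
      · exact zero_mem _
      · exact Sum.inl_ne_inr
    · exact subset_exampleIdeal (.inl (.inr ⟨p, q, rfl⟩))
    · exact subset_exampleIdeal (.inr ⟨w, _, isArrowMonomial_arr _, .inr rfl⟩)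
  · exact subset_exampleIdeal (.inr ⟨v, _, isArrowMonomial_arr _, .inl rfl⟩)

theorem exists_isITClass_one_exampleIdeal [Finite E] [Module.Finite k IB.ringCon.Quotient]
    (hself : Module.Injective (IB.ringCon.Quotient)ᵐᵒᵖ IB.ringCon.Quotient)
    (hιv : ∀ v : V, ι (vtx k s t v) = vtx k (gammaSrc s) (gammaTgt t) (Sum.inl v))
    (hιe : ∀ e : E, ι (arr k s t e) = arr k (gammaSrc s) (gammaTgt t) (Sum.inl e))
    (h : ∃ (m : ℕ) (W : FGMod ((exampleIdeal k V E s t IB ι).ringCon.Quotient)ᵐᵒᵖ),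
      IsITClass m W Set.univ) :
    ∃ W : FGMod ((exampleIdeal k V E s t IB ι).ringCon.Quotient)ᵐᵒᵖ,
      IsITClass 1 W Set.univ := by
  let qB := IB.ringCon.mkₐ k
  let q := (exampleIdeal k V E s t IB ι).ringCon.mkₐ k
  let x := vtx k (gammaSrc s) (gammaTgt t)
  let y := arr k (gammaSrc s) (gammaTgt t)
  have hqB : ∀ b ∈ IB, qB b = 0 := fun b => quotient_mk_eq_zero.2
  have hq : ∀ a ∈ exampleIdeal k V E s t IB ι, q a = 0 := fun a => quotient_mk_eq_zero.2
  -- The projection onto `B`.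
  obtain ⟨ρ', hρx', hρy'⟩ := exists_pathAlg_algHom (k := k) (gammaSrc s) (gammaTgt t)
    (Sum.elim (fun v => qB (vtx k s t v)) (0 : Fin 2 → IB.ringCon.Quotient))
    (Sum.elim (fun e => qB (arr k s t e)) 0)
    (by
      rintro (v | v) (w | w)
      · simp only [Sum.elim_inl, ← map_mul, vtx_mul_vtx, Sum.inl.injEq]
        split_ifs
        · rfl
        · exact map_zero _
      · simp
      · simp
      · simp)
    (by
      rw [Fintype.sum_sum_type]
      simp only [Sum.elim_inl, Sum.elim_inr, Pi.zero_apply, Finset.sum_const_zero, add_zero]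
      rw [← map_sum, sum_vtx, map_one])
    (by
      rintro (e | e)
      · simp only [Sum.elim_inl, gammaSrc, ← map_mul, vtx_mul_arr]
      · simp)
    (by
      rintro (e | e)
      · simp only [Sum.elim_inl, gammaTgt, ← map_mul, arr_mul_vtx]
      · simp)
  have hρι : ∀ b, ρ' (ι b) = qB b := by
    have : (ρ' : _ →ₙₐ[k] IB.ringCon.Quotient).comp ι = (qB : _ →ₙₐ[k] IB.ringCon.Quotient) :=
      nonUnitalAlgHom_pathAlg_ext s t
        (fun v => (congrArg ρ' (hιv v)).trans (hρx' _))
        (fun e => (congrArg ρ' (hιe e)).trans (hρy' _))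
    exact DFunLike.congr_fun this
  obtain ⟨ρ, hρ⟩ := exists_quotient_algHom (exampleIdeal k V E s t IB ι) ρ' fun a =>
    eq_zero_of_mem_exampleIdeal ρ' (fun b hb => by rw [hρι, hqB b hb]) (fun i => hρy' _)
  -- The two characters.
  have hχ : ∀ w : Fin 2, ∃ χ : (exampleIdeal k V E s t IB ι).ringCon.Quotient →ₐ[k] k,
      (∀ u, χ (q (x u)) = if u = Sum.inr w then 1 else 0) ∧ ∀ e, χ (q (y e)) = 0 := by
    intro w
    obtain ⟨χ', hx', hy'⟩ := exists_pathAlg_algHom (k := k) (gammaSrc s) (gammaTgt t)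
      (fun u => if u = Sum.inr w then (1 : k) else 0) 0
      (by
        intro u u'
        by_cases hu : u = Sum.inr w
        · by_cases hu' : u = u'
          · subst hu'; simp [hu]
          · have : u' ≠ Sum.inr w := fun h => hu' (hu.trans h.symm)
            simp [this, hu']
        · simp [hu])
      (by simp) (by simp) (by simp)
    have hχι : ∀ b, χ' (ι b) = 0 := by
      have : (χ' : _ →ₙₐ[k] k).comp ι = 0 :=
        nonUnitalAlgHom_pathAlg_ext s t
          (fun v => (congrArg χ' (hιv v)).trans (hx' _))
          (fun e => (congrArg χ' (hιe e)).trans (hy' _))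
      exact DFunLike.congr_fun this
    obtain ⟨χ, hχ⟩ := exists_quotient_algHom (exampleIdeal k V E s t IB ι) χ' fun a =>
      eq_zero_of_mem_exampleIdeal χ' (fun b hb => hχι b) (fun i => hy' _)
    exact ⟨χ, fun u => (hχ _).trans (hx' u), fun e => (hχ _).trans (hy' e)⟩
  choose χ hχx hχy using hχ
  -- The section.
  have hqι : ∀ b ∈ IB, q (ι b) = 0 := fun b hb =>
    hq _ (subset_exampleIdeal (.inl (.inl ⟨b, hb, rfl⟩)))
  let q' : PathAlg k (GammaV V) (GammaE V E) (gammaSrc s) (gammaTgt t) →ₙₐ[k]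
    (exampleIdeal k V E s t IB ι).ringCon.Quotient := q
  obtain ⟨j, hj⟩ := exists_quotient_nonUnitalAlgHom IB (q'.comp ι) hqι
  have hj : ∀ b, j (qB b) = q (ι b) := hj
  have hρ : ∀ a, ρ (q a) = ρ' a := hρ
  have hj1 : j 1 = ∑ v, q (x (Sum.inl v)) := by
    rw [← map_one qB, hj, ← sum_vtx k s t, map_sum, map_sum]
    simp only [hιv, x]
  have hsum : ∑ v, q (x (Sum.inl v)) + (q (x (Sum.inr 0)) + q (x (Sum.inr 1))) = 1 := by
    rw [← Fin.sum_univ_two (fun w => q (x (Sum.inr w))),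
      ← Fintype.sum_sum_type (fun u => q (x u)), ← map_sum, sum_vtx, map_one]
  have hxx : ∀ u u', q (x u) * q (x u') = if u = u' then q (x u) else 0 := by
    intro u u'
    rw [← map_mul, vtx_mul_vtx]
    split_ifs
    · rfl
    · exact map_zero _
  have hjq : ∀ b, j (qB b) * j 1 = j (qB b) := fun b => by rw [← map_mul, mul_one]
  refine exists_isITClass_one_of_adjoin hself ρ j χ (fun w => q (x (Sum.inr w)))
    (fun i => q (y (Sum.inr i))) ?_ ?_ ?_ ?_ ?_ ?_
    (q '' (Set.range x ∪ Set.range y)) ?_ ?_ ?_ ?_ h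
  · intro b
    obtain ⟨b, rfl⟩ := IB.ringCon.mkₐ_surjective (α := k) b
    rw [hj, hρ, hρι]
  · intro w
    rw [hχx, if_pos rfl]
  · rw [hj1, hsum]
  · intro w
    rw [hj1, Finset.sum_mul]
    exact Finset.sum_eq_zero fun v _ => by rw [hxx, if_neg Sum.inl_ne_inr]
  · intro w
    rw [hj1, Finset.mul_sum]
    exact Finset.sum_eq_zero fun v _ => by rw [hxx, if_neg Sum.inr_ne_inl]
  · intro w w'
    simp only [hxx, Sum.inr.injEq]
  · rw [← AlgHom.map_adjoin, adjoin_vtx_arr, Algebra.map_top, AlgHom.range_eq_top]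
    exact RingCon.mkₐ_surjective _
  · rintro _ ⟨_, ⟨v | w, rfl⟩ | ⟨e | i, rfl⟩, rfl⟩
    · rw [hρ, hρx', Sum.elim_inl, ← hjq, hj, hιv]
    · rw [hρ, hρx', Sum.elim_inr, Pi.zero_apply, map_zero, hj1, Finset.mul_sum]
      exact Finset.sum_eq_zero fun v _ => by rw [hxx, if_neg Sum.inr_ne_inl]
    · rw [hρ, hρy', Sum.elim_inl, ← hjq, hj, hιe]
    · rw [hρ, hρy', Sum.elim_inr, Pi.zero_apply, map_zero, hj1, Finset.mul_sum]
      refine Finset.sum_eq_zero fun v _ => ?_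
      rw [← map_mul, arr_mul_vtx_of_ne, map_zero]
      rcases i with _ | _ <;> exact Sum.inr_ne_inl
  · rintro _ ⟨_, ⟨u, rfl⟩ | ⟨e, rfl⟩, rfl⟩ w
    · rw [hχx, hxx]
      split_ifs with hu
      · rw [hu, one_smul, sub_self]
        exact zero_mem _
      · rw [zero_smul, sub_self]
        exact zero_mem _
    · rw [hχy, zero_smul, sub_zero, ← map_mul]
      by_cases he : gammaTgt t e = Sum.inr w
      · rw [← he, arr_mul_vtx]
        rcases e with e | i
        · exact absurd he Sum.inl_ne_inr
        · exact Submodule.subset_span ⟨i, rfl⟩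
      · rw [arr_mul_vtx_of_ne _ _ he, map_zero]
        exact zero_mem _
  · rintro _ ⟨_, ⟨u, rfl⟩ | ⟨e, rfl⟩, rfl⟩ i
    · by_cases hu : u = gammaSrc s (Sum.inr i)
      · exact ⟨1, by rw [← map_mul, hu, vtx_mul_arr, one_smul]⟩
      · exact ⟨0, by rw [← map_mul, vtx_mul_arr_of_ne _ _ hu, map_zero, zero_smul]⟩
    · exact ⟨0, by rw [← map_mul, hq _ (arr_mul_arr_mem_exampleIdeal e i), zero_smul]⟩

end Example

/-!
STATEMENT 19 (Proposition).  Let `B = kQ/I_B` be a finite dimensional selfinjective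
algebra and let `A = kΓ/I_A` be the algebra of Example 6.1 built from `Q` and the
quiver `Q'` (two vertices with loops and arrows in both directions).  If `A` is an
`m`-Igusa-Todorov algebra for some `m ∈ ℕ`, then `A` is `1`-Igusa-Todorov.
-/
theorem stmt_19 (k V E : Type u) [Field k] [Fintype V] [DecidableEq V] [Fintype E]
    (s t : E → V)
    (IB : TwoSidedIdeal (PathAlg k V E s t))
    -- `B = kQ/I_B` is finite dimensional:
    [Module.Finite k IB.ringCon.Quotient]
    -- `B` is selfinjective:
    (hself : Module.Injective (IB.ringCon.Quotient)ᵐᵒᵖ IB.ringCon.Quotient)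
    -- the canonical embedding `ι : kQ → kΓ`:
    (ι : PathAlg k V E s t →ₙₐ[k]
      PathAlg k (GammaV V) (GammaE V E) (gammaSrc s) (gammaTgt t))
    (hιv : ∀ v : V, ι (vtx k s t v) = vtx k (gammaSrc s) (gammaTgt t) (Sum.inl v))
    (hιe : ∀ e : E, ι (arr k s t e) = arr k (gammaSrc s) (gammaTgt t) (Sum.inl e)) :
    -- if `A` is `m`-Igusa-Todorov for some `m`, then `A` is `1`-Igusa-Todorov:
    (∃ (m : ℕ) (W : FGMod ((exampleIdeal k V E s t IB ι).ringCon.Quotient)ᵐᵒᵖ),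
      IsITClass m W Set.univ) →
    ∃ W : FGMod ((exampleIdeal k V E s t IB ι).ringCon.Quotient)ᵐᵒᵖ,
      IsITClass 1 W Set.univ := by
  exact exists_isITClass_one_exampleIdeal hself hιv hιe
end LIT
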